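/- For every prime power q with q ≡ 1 (mod 6) and q ≠ 13, there exists a Fano Kaleidoscopic difference family in the additive group of the finite field F_q; consequently, there exists an (F_q,+)-regular Fano Kaleidoscope FK(q). -/

import Mathlib

section KaleidoscopeDefs

variable {G V : Type*}

/-- The multiset of differences `x - y` over ordered pairs of distinct elements of `B`. -/
def diffMultiset [AddGroup G] [DecidableEq G] (B : Finset G) : Multiset G :=
  ((B ×ˢ B).filter fun p => p.1 ≠ p.2).val.map fun p => p.1 - p.2

/-- A `(G, k, lam)`-difference family, given as a multiset of blocks. -/
def IsDiffFamily [AddGroup G] [DecidableEq G] (k lam : ℕ) (𝓕 : Multiset (Finset G)) : Prop :=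
  (∀ B ∈ 𝓕, B.card = k) ∧ ∀ g : G, g ≠ 0 → (𝓕.bind diffMultiset).count g = lam

/-- The `j`-th line `{b_j, b_{j+1}, b_{j+3}}` (indices mod 7) of an ordered 7-tuple. -/
def fanoLine [DecidableEq G] (B : Fin 7 → G) (j : Fin 7) : Finset G :=
  {B j, B (j + 1), B (j + 3)}

/-- A Fano Kaleidoscopic difference family: a family of ordered 7-tuples of distinct
elements such that for each `j` the family of `j`-th lines is a `(G,3,1)`-DF. -/
def IsFKDF [AddGroup G] [DecidableEq G] (𝓕 : Multiset (Fin 7 → G)) : Prop :=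
  (∀ B ∈ 𝓕, Function.Injective B) ∧
    ∀ j : Fin 7, IsDiffFamily 3 1 (𝓕.map fun B => fanoLine B j)

/-- The `i`-th line of an ordered 9-tuple `(binf, b_0, …, b_7)`:
`{b_i, b_{i+1}, b_{i+3}}` (indices mod 8) for `0 ≤ i ≤ 7`, and
`{binf, b_{i-8}, b_{i-4}}` for `8 ≤ i ≤ 11`. -/
def hesseLine [DecidableEq G] (binf : G) (b : Fin 8 → G) (i : Fin 12) : Finset G :=
  if h : (i : ℕ) < 8 then
    {b ⟨i, h⟩, b (⟨i, h⟩ + 1), b (⟨i, h⟩ + 3)}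
  else
    {binf, b ⟨(i : ℕ) - 8, by have := i.isLt; omega⟩,
      b (⟨(i : ℕ) - 8, by have := i.isLt; omega⟩ + 4)}

/-- A Hesse Kaleidoscopic difference family: a family of ordered 9-tuples of distinct
elements such that for each `i` the family of `i`-th lines is a `(G,3,1)`-DF. -/
def IsHKDF [AddGroup G] [DecidableEq G] (𝓕 : Multiset (G × (Fin 8 → G))) : Prop :=
  (∀ B ∈ 𝓕, Function.Injective B.2 ∧ ∀ k, B.1 ≠ B.2 k) ∧
    ∀ i : Fin 12, IsDiffFamily 3 1 (𝓕.map fun B => hesseLine B.1 B.2 i)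

/-- The point set of a colored plane given by its (colored) lines. -/
def linesPts [DecidableEq V] {n : ℕ} (L : Fin n → Finset V) : Finset V :=
  Finset.univ.biUnion L

/-- `L` describes a Fano plane with points in `V`, where `L i` is the line colored `c_i`:
7 points, seven 3-element lines, and any two distinct points on exactly one line. -/
def IsColoredFano [DecidableEq V] (L : Fin 7 → Finset V) : Prop :=
  (linesPts L).card = 7 ∧ (∀ i, (L i).card = 3) ∧
    ∀ x y : V, x ∈ linesPts L → y ∈ linesPts L → x ≠ y →
      ∃! i : Fin 7, x ∈ L i ∧ y ∈ L i

/-- A Fano Kaleidoscope on the point set `V`: a multiset of line-colored Fano planes such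
that for all distinct `x y` and every color `i` exactly one plane has `x, y` on its
`c_i`-colored line. -/
def IsFanoKaleidoscope [DecidableEq V] (K : Multiset (Fin 7 → Finset V)) : Prop :=
  (∀ L ∈ K, IsColoredFano L) ∧
    ∀ x y : V, x ≠ y → ∀ i : Fin 7,
      Multiset.countP (fun L => x ∈ L i ∧ y ∈ L i) K = 1

/-- A `G`-regular Fano Kaleidoscope: a Fano Kaleidoscope with point set `G` invariant
(with colors) under all translations. -/
def IsRegularFK (G : Type*) [AddGroup G] [DecidableEq G]
    (K : Multiset (Fin 7 → Finset G)) : Prop :=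
  IsFanoKaleidoscope K ∧ ∀ g : G, K.map (fun L => fun i => (L i).image (· + g)) = K

/-- `L` describes a Hesse plane (an `AG(2,3)`) with points in `V`, where `L i` is the line
colored `c_i`. -/
def IsColoredHesse [DecidableEq V] (L : Fin 12 → Finset V) : Prop :=
  (linesPts L).card = 9 ∧ (∀ i, (L i).card = 3) ∧
    ∀ x y : V, x ∈ linesPts L → y ∈ linesPts L → x ≠ y →
      ∃! i : Fin 12, x ∈ L i ∧ y ∈ L i

/-- A Hesse Kaleidoscope on the point set `V`. -/
def IsHesseKaleidoscope [DecidableEq V] (K : Multiset (Fin 12 → Finset V)) : Prop :=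
  (∀ L ∈ K, IsColoredHesse L) ∧
    ∀ x y : V, x ≠ y → ∀ i : Fin 12,
      Multiset.countP (fun L => x ∈ L i ∧ y ∈ L i) K = 1

/-- A `G`-regular Hesse Kaleidoscope. -/
def IsRegularHK (G : Type*) [AddGroup G] [DecidableEq G]
    (K : Multiset (Fin 12 → Finset G)) : Prop :=
  IsHesseKaleidoscope K ∧ ∀ g : G, K.map (fun L => fun i => (L i).image (· + g)) = K

/-- An `(H, k, 1)`-difference matrix: a `k × |H|` matrix with entries in `H` such that the
difference of any two distinct rows contains each element of `H` exactly once. -/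
def IsDiffMatrix (H : Type*) [AddGroup H] [Fintype H] (k : ℕ)
    (M : Fin k → Fin (Fintype.card H) → H) : Prop :=
  ∀ r s : Fin k, r ≠ s → Function.Bijective fun c => M r c - M s c

/-- A 2-`(v, k, lam)` design (block multiset) on the point set `V`. -/
def Is2Design [DecidableEq V] (k lam : ℕ) (𝓑 : Multiset (Finset V)) : Prop :=
  (∀ b ∈ 𝓑, b.card = k) ∧
    ∀ x y : V, x ≠ y → Multiset.countP (fun b => x ∈ b ∧ y ∈ b) 𝓑 = lam

/-- A pairwise balanced design with block sizes in `K` on the point set `V`. -/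
def IsPBD [DecidableEq V] (K : Set ℕ) (𝓑 : Multiset (Finset V)) : Prop :=
  (∀ b ∈ 𝓑, b.card ∈ K) ∧
    ∀ x y : V, x ≠ y → Multiset.countP (fun b => x ∈ b ∧ y ∈ b) 𝓑 = 1

/-- Existence of a Fano Kaleidoscope of order `v`. -/
def ExistsFK (v : ℕ) : Prop :=
  ∃ K : Multiset (Fin 7 → Finset (Fin v)), IsFanoKaleidoscope K

end KaleidoscopeDefs


section PartA

lemma count_diffMultiset {G : Type*} [AddCommGroup G] [DecidableEq G] (B : Finset G) (g : G)
    (hg : g ≠ 0) :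
    (diffMultiset B).count g = ((B ×ˢ B).filter fun p => p.1 - p.2 = g).card := by
  unfold diffMultiset
  rw [Multiset.count_map]
  rw [← Finset.filter_val, Finset.filter_filter]
  change Finset.card _ = _
  congr 1
  ext p
  simp only [Finset.mem_filter]
  constructor
  · rintro ⟨h, _, h2⟩
    exact ⟨h, h2.symm⟩
  · rintro ⟨h, h2⟩
    refine ⟨h, ?_, h2.symm⟩
    intro h3
    apply hg
    rw [← h2, h3, sub_self]

lemma card_translates {G : Type*} [AddCommGroup G] [Fintype G] [DecidableEq G] (B : Finset G)
    (x y : G) (hxy : x ≠ y) :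
    (Finset.univ.filter fun g : G => x ∈ B.image (· + g) ∧ y ∈ B.image (· + g)).card
      = (diffMultiset B).count (x - y) := by
  rw [count_diffMultiset B _ (sub_ne_zero.mpr hxy)]
  apply Finset.card_bij' (fun g _ => (x - g, y - g)) (fun p _ => x - p.1)
  · intro g hg
    simp only [Finset.mem_filter, Finset.mem_univ, true_and, Finset.mem_image,
      Finset.mem_product] at hg ⊢
    obtain ⟨⟨u, hu, hu'⟩, ⟨v, hv, hv'⟩⟩ := hg
    refine ⟨⟨?_, ?_⟩, by abel⟩
    · rw [← hu']; simpa using hu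
    · rw [← hv']; simpa using hv
  · rintro ⟨u, v⟩ hp
    simp only [Finset.mem_filter, Finset.mem_univ, true_and, Finset.mem_image,
      Finset.mem_product] at hp ⊢
    obtain ⟨⟨hu, hv⟩, h⟩ := hp
    refine ⟨⟨u, hu, by abel⟩, ⟨v, hv, ?_⟩⟩
    have : v = u - (x - y) := by rw [← h]; abel
    rw [this]; abel
  · intro g hg
    simp
  · rintro ⟨u, v⟩ hp
    simp only [Finset.mem_filter, Finset.mem_product] at hp ⊢
    have h := hp.2
    have : v = u - (x - y) := by rw [← h]; abel
    rw [this]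
    exact Prod.ext (by simp) (by simp; abel)

lemma fanoLine_eq_image {G : Type*} [DecidableEq G] (B : Fin 7 → G) (j : Fin 7) :
    fanoLine B j = (fanoLine (id : Fin 7 → Fin 7) j).image B := by
  simp [fanoLine, Finset.image_insert]

lemma isColoredFano_of_injective {G : Type*} [DecidableEq G] (B : Fin 7 → G)
    (hB : Function.Injective B) : IsColoredFano (fun j => fanoLine B j) := by
  have hpts : linesPts (fun j => fanoLine B j) = Finset.univ.image B := by
    ext x
    simp only [linesPts, Finset.mem_biUnion, Finset.mem_univ, true_and, Finset.mem_image]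
    constructor
    · rintro ⟨j, hj⟩
      rw [fanoLine_eq_image, Finset.mem_image] at hj
      obtain ⟨k, -, hk⟩ := hj
      exact ⟨k, hk⟩
    · rintro ⟨k, hk⟩
      exact ⟨k, by simp [fanoLine, hk]⟩
  have hmem : ∀ i j : Fin 7, B i ∈ fanoLine B j ↔ i ∈ fanoLine (id : Fin 7 → Fin 7) j := by
    intro i j
    rw [fanoLine_eq_image]
    exact hB.mem_finset_image
  refine ⟨?_, ?_, ?_⟩
  · rw [hpts, Finset.card_image_of_injective _ hB]; rfl
  · intro i
    show (fanoLine B i).card = 3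
    rw [fanoLine_eq_image, Finset.card_image_of_injective _ hB]
    revert i; decide
  · intro x y hx hy hxy
    rw [hpts] at hx hy
    simp only [Finset.mem_image, Finset.mem_univ, true_and] at hx hy
    obtain ⟨i, rfl⟩ := hx
    obtain ⟨k, rfl⟩ := hy
    have hik : i ≠ k := fun h => hxy (by rw [h])
    simp only [hmem]
    have key : ∀ i k : Fin 7, i ≠ k → ∃! j : Fin 7, i ∈ fanoLine (id : Fin 7 → Fin 7) j ∧
        k ∈ fanoLine (id : Fin 7 → Fin 7) j := by
      simp only [ExistsUnique]
      decide
    exact key i k hik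

theorem exists_regularFK_of_FKDF {G : Type*} [AddCommGroup G] [Fintype G] [DecidableEq G]
    (𝓕 : Multiset (Fin 7 → G)) (h : IsFKDF 𝓕) :
    ∃ K : Multiset (Fin 7 → Finset G), IsRegularFK G K := by
  refine ⟨𝓕.bind fun B => (Finset.univ : Finset G).val.map
    fun g => fun i => (fanoLine B i).image (· + g), ⟨?_, ?_⟩, ?_⟩
  · intro L hL
    simp only [Multiset.mem_bind, Multiset.mem_map, Finset.mem_val, Finset.mem_univ,
      true_and] at hL
    obtain ⟨B, hB, g, rfl⟩ := hL
    have hinj : Function.Injective (fun i => B i + g) := by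
      intro i j hij
      exact h.1 B hB (add_right_cancel hij)
    have := isColoredFano_of_injective _ hinj
    convert this using 2 with i
    simp [fanoLine, Finset.image_insert]
  · intro x y hxy i
    rw [Multiset.countP_eq_card_filter, Multiset.filter_bind, Multiset.card_bind]
    have h2 := (h.2 i).2 (x - y) (sub_ne_zero.mpr hxy)
    rw [Multiset.count_bind, Multiset.map_map] at h2
    rw [← h2]
    congr 1
    apply Multiset.map_congr rfl
    intro B hB
    simp only [Function.comp]
    rw [← card_translates _ x y hxy, Multiset.filter_map, Multiset.card_map]
    rfl
  · intro g
    rw [Multiset.map_bind]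
    apply Multiset.bind_congr
    intro B hB
    rw [Multiset.map_map]
    have : (Finset.univ : Finset G).val = ((Finset.univ : Finset G).val).map (· + g) := by
      have := congrArg Finset.val (Finset.map_univ_equiv (Equiv.addRight g))
      rw [Finset.map_val] at this
      exact this.symm
    conv_rhs => rw [this, Multiset.map_map]
    apply Multiset.map_congr rfl
    intro a ha
    funext i
    simp only [Function.comp, Finset.image_image]
    congr 1
    funext u
    simp [add_assoc]

end PartA

section PartB

lemma diffMultiset_triple {G : Type*} [AddCommGroup G] [DecidableEq G] (a b c : G)
    (hab : a ≠ b) (hac : a ≠ c) (hbc : b ≠ c) :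
    diffMultiset {a, b, c} = {a - b, b - a, a - c, c - a, b - c, c - b} := by
  have : ((({a, b, c} : Finset G) ×ˢ ({a, b, c} : Finset G)).filter fun p => p.1 ≠ p.2)
      = {(a, b), (b, a), (a, c), (c, a), (b, c), (c, b)} := by
    ext ⟨u, v⟩
    simp only [Finset.mem_filter, Finset.mem_product, Finset.mem_insert, Finset.mem_singleton,
      Prod.mk.injEq]
    constructor
    · rintro ⟨⟨rfl | rfl | rfl, rfl | rfl | rfl⟩, h⟩ <;> simp_all
    · rintro (⟨rfl, rfl⟩ | ⟨rfl, rfl⟩ | ⟨rfl, rfl⟩ | ⟨rfl, rfl⟩ | ⟨rfl, rfl⟩ | ⟨rfl, rfl⟩) <;>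
        simp_all [eq_comm]
  unfold diffMultiset
  rw [this]
  rw [Finset.insert_val_of_notMem, Finset.insert_val_of_notMem, Finset.insert_val_of_notMem,
    Finset.insert_val_of_notMem, Finset.insert_val_of_notMem, Finset.singleton_val]
  · rfl
  all_goals simp [hab, hac, hbc, hab.symm, hac.symm, hbc.symm]

/-- A set of representatives of the pairs `{s, -s}` in a symmetric subset. -/
lemma exists_half {F : Type*} [Field F] [Fintype F] [DecidableEq F] (h2 : (-1 : F) ≠ 1)
    (H : Finset F) (h0 : (0 : F) ∉ H) (hneg : ∀ s ∈ H, -s ∈ H) :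
    ∃ S : Finset F, S ⊆ H ∧ ∀ s : F, (if s ∈ S then 1 else 0) + (if -s ∈ S then 1 else 0)
      = if s ∈ H then 1 else 0 := by
  classical
  let e := Fintype.equivFin F
  refine ⟨H.filter fun s => e s < e (-s), Finset.filter_subset _ _, ?_⟩
  intro s
  simp only [Finset.mem_filter, neg_neg]
  by_cases hs : s ∈ H
  · have hns := hneg s hs
    have hne : e s ≠ e (-s) := by
      intro h
      have h' := e.injective h
      have hs0 : s ≠ 0 := fun h => h0 (h ▸ hs)
      apply h2
      have : s * (-1) = s * 1 := by rw [mul_one, mul_neg_one, ← h']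
      exact mul_left_cancel₀ hs0 this
    rcases lt_or_gt_of_ne hne with h | h
    · simp [hs, hns, h, h.le]
    · simp [hs, hns, h, h.le]
  · have hns : -s ∉ H := fun h => hs (by simpa using hneg _ h)
    simp [hs, hns]

lemma cube_roots_ne {M : Type*} [Field M] (h3 : (3 : M) ≠ 0) (a b c : M) (ha : a ^ 3 = 1)
    (hc : c ^ 3 = 1) (hs : a + b + c = 0) : a ≠ b := by
  rintro rfl
  have hc' : c = -2 * a := by linear_combination hs
  rw [hc'] at hc
  apply h3
  have : (3 : M) * 3 = 0 := by linear_combination -hc - 8 * ha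
  simpa using this

lemma cube_exact {M : Type*} [Field M] [DecidableEq M] (h3 : (3 : M) ≠ 0) (a b c d : M)
    (ha : a ^ 3 = 1) (hb : b ^ 3 = 1) (hc : c ^ 3 = 1) (hd : d ^ 3 = 1) (hs : a + b + c = 0) :
    (if a = d then 1 else 0) + (if b = d then 1 else 0) + (if c = d then 1 else 0) = 1 := by
  have hab := cube_roots_ne h3 a b c ha hc hs
  have hac := cube_roots_ne h3 a c b ha hb (by linear_combination hs)
  have hbc := cube_roots_ne h3 b c a hb ha (by linear_combination hs)
  have hq : a ^ 2 + a * b + b ^ 2 = 0 := by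
    have : (a - b) * (a ^ 2 + a * b + b ^ 2) = 0 := by linear_combination ha - hb
    rcases mul_eq_zero.mp this with h | h
    · exact absurd (sub_eq_zero.mp h) hab
    · exact h
  have hprod : (d - a) * (d - b) * (d - c) = 0 := by
    have hc' : c = -(a + b) := by linear_combination hs
    rw [hc']
    linear_combination hd - ha - (d - a) * hq
  rcases mul_eq_zero.mp hprod with h | h
  · rcases mul_eq_zero.mp h with h | h
    · have : d = a := sub_eq_zero.mp h
      subst this
      simp [hab.symm, hac.symm]
    · have : d = b := sub_eq_zero.mp h
      subst this
      simp [hab, hbc.symm]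
  · have : d = c := sub_eq_zero.mp h
    subst this
    simp [hac, hbc]

/-- A 7-tuple all of whose Fano lines are rainbow for the cubic character `κ`. -/
def Rainbow7 {F M : Type*} [Field F] [Field M] (κ : F →* M) (B : Fin 7 → F) : Prop :=
  ∀ j : Fin 7, (B j ≠ B (j + 1) ∧ B j ≠ B (j + 3) ∧ B (j + 1) ≠ B (j + 3)) ∧
    κ (B j - B (j + 1)) + κ (B j - B (j + 3)) + κ (B (j + 1) - B (j + 3)) = 0

lemma Rainbow7.injective {F M : Type*} [Field F] [Field M] {κ : F →* M} {B : Fin 7 → F}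
    (h : Rainbow7 κ B) : Function.Injective B := by
  intro i k hik
  by_contra hne
  have key : ∀ i k : Fin 7, i ≠ k → ∃ j : Fin 7, (i = j ∧ k = j + 1) ∨ (i = j ∧ k = j + 3) ∨
      (i = j + 1 ∧ k = j + 3) ∨ (k = j ∧ i = j + 1) ∨ (k = j ∧ i = j + 3) ∨
      (k = j + 1 ∧ i = j + 3) := by decide
  obtain ⟨j, hj⟩ := key i k hne
  obtain ⟨⟨h1, h2, h3⟩, -⟩ := h j
  rcases hj with ⟨rfl, rfl⟩ | ⟨rfl, rfl⟩ | ⟨rfl, rfl⟩ | ⟨rfl, rfl⟩ | ⟨rfl, rfl⟩ | ⟨rfl, rfl⟩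
  · exact h1 hik
  · exact h2 hik
  · exact h3 hik
  · exact h1 hik.symm
  · exact h2 hik.symm
  · exact h3 hik.symm

lemma sum_count_mul {F : Type*} [Field F] [DecidableEq F] (S : Finset F) (d g : F) (hd : d ≠ 0) :
    (∑ s ∈ S, if g = s * d then 1 else 0) = if g / d ∈ S then 1 else 0 := by
  have : ∀ s ∈ S, (if g = s * d then 1 else 0) = if g / d = s then 1 else 0 := by
    intro s _
    congr 1
    rw [eq_iff_iff, div_eq_iff hd]
  rw [Finset.sum_congr rfl this, Finset.sum_ite_eq]

theorem exists_FKDF_of_rainbow {F M : Type*} [Field F] [Fintype F] [DecidableEq F] [Field M]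
    (κ : F →* M) (h3 : (3 : M) ≠ 0) (hκ : ∀ u : F, u ≠ 0 → κ u ^ 3 = 1) (hneg : κ (-1) = 1)
    (h2 : (-1 : F) ≠ 1) (B : Fin 7 → F) (hB : Rainbow7 κ B) :
    ∃ 𝓕 : Multiset (Fin 7 → F), IsFKDF 𝓕 := by
  classical
  let H : Finset F := Finset.univ.filter fun s => s ≠ 0 ∧ κ s = 1
  obtain ⟨S, hSH, hS⟩ := exists_half h2 H (by simp [H]) (by
    intro s hs
    simp only [H, Finset.mem_filter, Finset.mem_univ, true_and] at hs ⊢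
    refine ⟨neg_ne_zero.mpr hs.1, ?_⟩
    rw [← neg_one_mul, map_mul, hneg, hs.2, one_mul])
  have hS0 : ∀ s ∈ S, s ≠ 0 := by
    intro s hs
    have := hSH hs
    simp only [H, Finset.mem_filter, Finset.mem_univ, true_and] at this
    exact this.1
  refine ⟨S.val.map fun s => fun i => s * B i, ?_, ?_⟩
  · intro B' hB'
    simp only [Multiset.mem_map, Finset.mem_val] at hB'
    obtain ⟨s, hs, rfl⟩ := hB'
    intro i j hij
    exact hB.injective (mul_left_cancel₀ (hS0 s hs) hij)
  · intro j
    obtain ⟨⟨d1, d2, d3⟩, hsum⟩ := hB j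
    refine ⟨?_, ?_⟩
    · intro L hL
      simp only [Multiset.mem_map, Finset.mem_val] at hL
      obtain ⟨_, ⟨s, hs, rfl⟩, rfl⟩ := hL
      have hs0 := hS0 s hs
      unfold fanoLine
      rw [Finset.card_eq_three]
      exact ⟨_, _, _, fun h => d1 (mul_left_cancel₀ hs0 h), fun h => d2 (mul_left_cancel₀ hs0 h),
        fun h => d3 (mul_left_cancel₀ hs0 h), rfl⟩
    · intro g hg
      rw [Multiset.count_bind, Multiset.map_map, Multiset.map_map]
      change ∑ s ∈ S, _ = 1
      set a := B j
      set b := B (j + 1)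
      set c := B (j + 3)
      have step : ∀ s ∈ S, Multiset.count g (diffMultiset (fanoLine (fun i => s * B i) j))
          = (if g = s * (a - b) then 1 else 0) + (if g = s * (b - a) then 1 else 0)
          + ((if g = s * (a - c) then 1 else 0) + (if g = s * (c - a) then 1 else 0))
          + ((if g = s * (b - c) then 1 else 0) + (if g = s * (c - b) then 1 else 0)) := by
        intro s hs
        have hs0 := hS0 s hs
        unfold fanoLine
        rw [diffMultiset_triple _ _ _ (fun h => d1 (mul_left_cancel₀ hs0 h))
          (fun h => d2 (mul_left_cancel₀ hs0 h)) (fun h => d3 (mul_left_cancel₀ hs0 h))]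
        simp only [Multiset.insert_eq_cons, Multiset.count_cons, Multiset.count_singleton,
          ← mul_sub]
        ring
      have hpair : ∀ d : F, d ≠ 0 → (if g / d ∈ S then 1 else 0) + (if g / -d ∈ S then 1 else 0)
          = if κ d = κ g then 1 else 0 := by
        intro d hd
        rw [div_neg, hS (g / d)]
        congr 1
        simp only [H, Finset.mem_filter, Finset.mem_univ, true_and, eq_iff_iff]
        have hm : κ (g / d) * κ d = κ g := by rw [← map_mul, div_mul_cancel₀ _ hd]
        have hd' : κ d ≠ 0 := by
          intro h0
          have := hκ d hd
          rw [h0] at this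
          simp at this
        constructor
        · rintro ⟨_, h⟩
          rw [h, one_mul] at hm
          exact hm
        · intro h
          refine ⟨div_ne_zero hg hd, ?_⟩
          rw [← h] at hm
          exact mul_right_cancel₀ hd' (by rw [hm, one_mul])
      have e1 : a - b ≠ 0 := sub_ne_zero.mpr d1
      have e2 : a - c ≠ 0 := sub_ne_zero.mpr d2
      have e3 : b - c ≠ 0 := sub_ne_zero.mpr d3
      refine (Finset.sum_congr rfl step).trans ?_
      simp only [Finset.sum_add_distrib]
      rw [← neg_sub a b, ← neg_sub a c, ← neg_sub b c]
      rw [sum_count_mul S _ g e1, sum_count_mul S _ g (neg_ne_zero.mpr e1),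
        sum_count_mul S _ g e2, sum_count_mul S _ g (neg_ne_zero.mpr e2),
        sum_count_mul S _ g e3, sum_count_mul S _ g (neg_ne_zero.mpr e3),
        hpair _ e1, hpair _ e2, hpair _ e3]
      exact cube_exact h3 _ _ _ _ (hκ _ e1) (hκ _ e2) (hκ _ e3) (hκ _ hg) hsum

end PartB

section PartC

lemma exists_reps {K F : Type*} [Field K] [Field F] [Fintype F] (ι : K →+* F) :
    ∃ T : Finset F, (∀ s ∈ T, s ≠ 0) ∧ ∀ g : F, g ≠ 0 →
      ∃ s ∈ T, (∃ k : K, k ≠ 0 ∧ g = s * ι k) ∧ ∀ s' ∈ T, (∃ k : K, g = s' * ι k) → s' = s := by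
  classical
  let U : Subgroup Fˣ := (Units.map (ι : K →* F)).range
  let r : Fˣ → Fˣ := fun u => Quotient.out (QuotientGroup.mk u : Fˣ ⧸ U)
  have hr : ∀ u, ∃ k : Kˣ, u = r u * Units.map (ι : K →* F) k := by
    intro u
    have : (QuotientGroup.mk (r u) : Fˣ ⧸ U) = QuotientGroup.mk u := Quotient.out_eq _
    obtain ⟨k, hk⟩ := QuotientGroup.eq.mp this
    exact ⟨k, by rw [hk]; simp⟩
  refine ⟨Finset.univ.image fun u : Fˣ => ((r u : Fˣ) : F), ?_, ?_⟩
  · intro s hs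
    simp only [Finset.mem_image, Finset.mem_univ, true_and] at hs
    obtain ⟨u, rfl⟩ := hs
    exact Units.ne_zero _
  · intro g hg
    obtain ⟨k, hk⟩ := hr (Units.mk0 g hg)
    refine ⟨r (Units.mk0 g hg), by simp, ⟨k, k.ne_zero, ?_⟩, ?_⟩
    · simpa using congrArg Units.val hk
    · intro s' hs' ⟨k', hk'⟩
      simp only [Finset.mem_image, Finset.mem_univ, true_and] at hs'
      obtain ⟨u, rfl⟩ := hs'
      have hk0 : k' ≠ 0 := by
        rintro rfl
        apply hg
        rw [hk']; simp
      have h1 : Units.mk0 g hg = r u * Units.map (ι : K →* F) (Units.mk0 k' hk0) := by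
        ext
        simpa using hk'
      have h2 : (QuotientGroup.mk (Units.mk0 g hg) : Fˣ ⧸ U) = QuotientGroup.mk u := by
        rw [h1]
        have h3 : (QuotientGroup.mk (r u) : Fˣ ⧸ U) = QuotientGroup.mk u := Quotient.out_eq _
        rw [← h3]
        symm
        rw [QuotientGroup.eq]
        exact ⟨Units.mk0 k' hk0, by simp⟩
      simp only [r, h2]

lemma diffMultiset_image {G G' : Type*} [AddCommGroup G] [AddCommGroup G'] [DecidableEq G]
    [DecidableEq G'] (f : G → G') (hf : Function.Injective f)
    (hsub : ∀ x y, f (x - y) = f x - f y) (B : Finset G) :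
    diffMultiset (B.image f) = (diffMultiset B).map f := by
  unfold diffMultiset
  rw [Multiset.map_map]
  have : (B.image f ×ˢ B.image f).filter (fun p => p.1 ≠ p.2)
      = ((B ×ˢ B).filter fun p => p.1 ≠ p.2).map ⟨Prod.map f f, hf.prodMap hf⟩ := by
    ext ⟨u, v⟩
    simp only [Finset.mem_filter, Finset.mem_product, Finset.mem_image, Finset.mem_map,
      Function.Embedding.coeFn_mk, Prod.exists, Prod.map_apply, Prod.mk.injEq]
    constructor
    · rintro ⟨⟨⟨a, ha, rfl⟩, ⟨b, hb, rfl⟩⟩, h⟩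
      exact ⟨a, b, ⟨⟨ha, hb⟩, fun h' => h (by rw [h'])⟩, rfl, rfl⟩
    · rintro ⟨a, b, ⟨⟨ha, hb⟩, h⟩, rfl, rfl⟩
      exact ⟨⟨⟨a, ha, rfl⟩, ⟨b, hb, rfl⟩⟩, fun h' => h (hf h')⟩
  rw [this, Finset.map_val, Multiset.map_map]
  apply Multiset.map_congr rfl
  intro p _
  simp [hsub]

theorem exists_FKDF_lift {K F : Type*} [Field K] [DecidableEq K] [Field F] [Fintype F]
    [DecidableEq F] (ι : K →+* F) (h : ∃ 𝓕 : Multiset (Fin 7 → K), IsFKDF 𝓕) :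
    ∃ 𝓕 : Multiset (Fin 7 → F), IsFKDF 𝓕 := by
  obtain ⟨𝓕, hF1, hF2⟩ := h
  obtain ⟨T, hT0, hT⟩ := exists_reps ι
  have hinj : ∀ s ∈ T, Function.Injective (fun k : K => s * ι k) := by
    intro s hs x y hxy
    exact ι.injective (mul_left_cancel₀ (hT0 s hs) hxy)
  refine ⟨T.val.bind fun s => 𝓕.map fun B => fun i => s * ι (B i), ?_, ?_⟩
  · intro B' hB'
    simp only [Multiset.mem_bind, Multiset.mem_map, Finset.mem_val] at hB'
    obtain ⟨s, hs, B, hB, rfl⟩ := hB'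
    intro i j hij
    exact hF1 B hB (hinj s hs hij)
  · intro j
    have hline : ∀ (s : F) (B : Fin 7 → K),
        fanoLine (fun i => s * ι (B i)) j = (fanoLine B j).image (fun k => s * ι k) := by
      intro s B
      simp [fanoLine, Finset.image_insert]
    obtain ⟨hc, hd⟩ := hF2 j
    refine ⟨?_, ?_⟩
    · intro L hL
      simp only [Multiset.mem_bind, Multiset.mem_map, Finset.mem_val] at hL
      obtain ⟨_, ⟨s, hs, B, hB, rfl⟩, rfl⟩ := hL
      rw [hline, Finset.card_image_of_injective _ (hinj s hs)]
      exact hc _ (Multiset.mem_map_of_mem _ hB)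
    · intro g hg
      obtain ⟨s, hs, ⟨k, hk0, hk⟩, huniq⟩ := hT g hg
      rw [Multiset.map_bind, Multiset.bind_assoc, Multiset.count_bind]
      change ∑ s ∈ T, _ = 1
      have key : ∀ s' ∈ T, Multiset.count g
          ((Multiset.map (fun B => fanoLine B j) (𝓕.map fun B => fun i => s' * ι (B i))).bind
            diffMultiset) = if s' = s then 1 else 0 := by
        intro s' hs'
        have e1 : (Multiset.map (fun B => fanoLine B j)
            (𝓕.map fun B => fun i => s' * ι (B i))).bind diffMultiset
            = ((𝓕.map fun B => fanoLine B j).bind diffMultiset).map (fun k => s' * ι k) := by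
          rw [Multiset.map_bind, Multiset.map_map, Multiset.bind_map, Multiset.bind_map]
          apply Multiset.bind_congr
          intro B hB
          simp only [Function.comp]
          rw [hline, diffMultiset_image _ (hinj s' hs')]
          intro x y
          simp [mul_sub]
        rw [e1]
        split_ifs with hss
        · subst hss
          rw [hk, Multiset.count_map_eq_count' _ _ (hinj _ hs') k]
          exact hd k hk0
        · rw [Multiset.count_eq_zero]
          intro hmem
          rw [Multiset.mem_map] at hmem
          obtain ⟨k', _, hk'⟩ := hmem
          exact hss (huniq s' hs' ⟨k', hk'.symm⟩)
      refine (Finset.sum_congr rfl key).trans ?_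
      rw [Finset.sum_ite_eq']
      simp [hs]

end PartC

section PartD

set_option linter.unusedSectionVars false

open Finset ComplexConjugate

variable {F : Type*} [Field F] [Fintype F] [DecidableEq F]

lemma chi_conj (χ : MulChar F ℂ) (a : F) : conj (χ a) = χ⁻¹ a := by
  simpa using MulChar.star_apply' χ a

lemma chi_norm_le (χ : MulChar F ℂ) (a : F) : ‖χ a‖ ≤ 1 := by
  by_cases ha : a = 0
  · simp [ha, MulChar.map_zero]
  · have h : χ a ^ (Fintype.card F - 1) = 1 := by
      rw [← map_pow, FiniteField.pow_card_sub_one_eq_one a ha, map_one]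
    have hq : Fintype.card F - 1 ≠ 0 := by
      have := Fintype.one_lt_card (α := F)
      omega
    exact (Complex.norm_eq_one_of_pow_eq_one h hq).le

lemma chi_orth (χ : MulChar F ℂ) (hχ : χ ≠ 1) (y y' : F) :
    ∑ d, χ (y - d) * conj (χ (y' - d)) = (if y = y' then (Fintype.card F : ℂ) else 0) - 1 := by
  simp only [chi_conj]
  split_ifs with h
  · subst h
    have h1 : ∀ d, χ (y - d) * χ⁻¹ (y - d) = if d = y then 0 else 1 := by
      intro d
      split_ifs with hd
      · simp [hd, MulChar.map_zero]
      · rw [← MulChar.mul_apply, mul_inv_cancel, MulChar.one_apply]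
        exact (sub_ne_zero.mpr (Ne.symm hd)).isUnit
    rw [sum_congr rfl fun d _ => h1 d]
    have h2 : ∀ d, (if d = y then (0 : ℂ) else 1) = 1 - if d = y then 1 else 0 := by
      intro d
      split_ifs <;> simp
    simp only [h2, sum_sub_distrib, sum_ite_eq', mem_univ, if_true]
    simp
  · have hc : y' - y ≠ 0 := sub_ne_zero.mpr (Ne.symm h)
    -- d = y' - (y' - y) * t
    have e : ∑ d, χ (y - d) * χ⁻¹ (y' - d)
        = ∑ t, χ ((y' - y) * (t - 1)) * χ⁻¹ ((y' - y) * t) := by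
      let σ : F ≃ F := (Equiv.mulLeft₀ (y' - y) hc).trans (Equiv.subLeft y')
      rw [← Equiv.sum_comp σ]
      apply sum_congr rfl
      intro t _
      have : σ t = y' - (y' - y) * t := rfl
      rw [this]
      congr 2 <;> ring
    rw [e]
    have hJ := jacobiSum_nontrivial_inv hχ
    rw [jacobiSum_comm] at hJ
    unfold jacobiSum at hJ
    have h1 : ∀ t, χ ((y' - y) * (t - 1)) * χ⁻¹ ((y' - y) * t)
        = χ (-1) * (χ⁻¹ t * χ (1 - t)) := by
      intro t
      have e2 : (y' - y) * (t - 1) = (y' - y) * (-1 * (1 - t)) := by ring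
      rw [e2, map_mul χ, map_mul χ⁻¹, map_mul χ (-1)]
      have e3 : χ (y' - y) * χ⁻¹ (y' - y) = 1 := by
        rw [← MulChar.mul_apply, mul_inv_cancel, MulChar.one_apply hc.isUnit]
      linear_combination (χ (-1) * χ (1 - t) * χ⁻¹ t) * e3
    rw [sum_congr rfl fun t _ => h1 t, ← mul_sum, hJ]
    have : χ (-1) * χ (-1) = 1 := by rw [← map_mul]; simp
    linear_combination -this

lemma parseval_le (χ : MulChar F ℂ) (hχ : χ ≠ 1) (h : F → ℂ) :
    ∑ d, ‖∑ x, h x * χ (x - d)‖ ^ 2 ≤ Fintype.card F * ∑ x, ‖h x‖ ^ 2 := by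
  have key : ((∑ d, ‖∑ x, h x * χ (x - d)‖ ^ 2 : ℝ) : ℂ)
      = Fintype.card F * ((∑ x, ‖h x‖ ^ 2 : ℝ) : ℂ) - ((‖∑ x, h x‖ ^ 2 : ℝ) : ℂ) := by
    push_cast
    simp only [← Complex.mul_conj', map_sum, map_mul]
    calc ∑ d, (∑ x, h x * χ (x - d)) * (∑ x, conj (h x) * conj (χ (x - d)))
        = ∑ d, ∑ x, ∑ x', h x * conj (h x') * (χ (x - d) * conj (χ (x' - d))) := by
          apply sum_congr rfl
          intro d _
          rw [sum_mul_sum]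
          apply sum_congr rfl
          intro x _
          apply sum_congr rfl
          intro x' _
          ring
      _ = ∑ x, ∑ x', h x * conj (h x') * ∑ d, (χ (x - d) * conj (χ (x' - d))) := by
          rw [sum_comm]
          apply sum_congr rfl
          intro x _
          rw [sum_comm]
          apply sum_congr rfl
          intro x' _
          rw [mul_sum]
      _ = _ := by
          simp only [chi_orth χ hχ, mul_sub, sum_sub_distrib, mul_ite, mul_zero, mul_one,
            sum_ite_eq, mem_univ, if_true]
          rw [sum_mul_sum, mul_sum]
          congr 1
          apply sum_congr rfl
          intro x _
          ring
  have key' : (∑ d, ‖∑ x, h x * χ (x - d)‖ ^ 2 : ℝ)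
      = Fintype.card F * (∑ x, ‖h x‖ ^ 2 : ℝ) - (‖∑ x, h x‖ ^ 2 : ℝ) := by
    exact_mod_cast key
  rw [key']
  have := sq_nonneg ‖∑ x, h x‖
  linarith

/-- The fluctuating part of the (normalized) rainbow indicator. -/
noncomputable def rbErr (χ : MulChar F ℂ) (x b d : F) : ℝ :=
  (2 * (χ (x - b) * χ (x - d) * χ (b - d)) - χ (x - b) * conj (χ (x - d))
    - χ (x - d) * conj (χ (b - d)) - χ (b - d) * conj (χ (x - b))).re

lemma rbErr_sum_le (χ : MulChar F ℂ) (f : F → ℝ) (b d : F) :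
    (∑ x, f x * rbErr χ x b d) ^ 2 ≤
      5 * (2 * ‖∑ x, ((f x : ℂ) * χ (x - b)) * χ (x - d)‖ ^ 2
        + ‖∑ x, ((f x : ℂ) * conj (χ (x - b))) * χ (x - d)‖ ^ 2
        + ‖∑ x, (f x : ℂ) * χ (x - d)‖ ^ 2 + ‖∑ x, (f x : ℂ) * χ (x - b)‖ ^ 2) := by
  set S1 := ∑ x, ((f x : ℂ) * χ (x - b)) * χ (x - d) with hS1
  set S2 := ∑ x, ((f x : ℂ) * conj (χ (x - b))) * χ (x - d) with hS2
  set S3 := ∑ x, (f x : ℂ) * χ (x - d) with hS3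
  set S4 := ∑ x, (f x : ℂ) * χ (x - b) with hS4
  have e : ∑ x, f x * rbErr χ x b d =
      (2 * (S1 * χ (b - d)) - conj S2 - S3 * conj (χ (b - d)) - χ (b - d) * conj S4).re := by
    have : ∀ x, f x * rbErr χ x b d = ((f x : ℂ) * (2 * (χ (x - b) * χ (x - d) * χ (b - d))
        - χ (x - b) * conj (χ (x - d))
        - χ (x - d) * conj (χ (b - d)) - χ (b - d) * conj (χ (x - b)))).re := by
      intro x
      rw [Complex.re_ofReal_mul]
      rfl
    rw [sum_congr rfl fun x _ => this x, ← Complex.re_sum]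
    congr 1
    rw [hS1, hS2, hS3, hS4]
    simp only [map_sum, map_mul, Complex.conj_conj, Complex.conj_ofReal, sum_mul, mul_sum,
      ← sum_sub_distrib]
    apply sum_congr rfl
    intro x _
    ring
  have hC := chi_norm_le χ (b - d)
  have b1 : ‖S1 * χ (b - d)‖ ≤ ‖S1‖ := by
    rw [norm_mul]; exact mul_le_of_le_one_right (norm_nonneg _) hC
  have b3 : ‖S3 * conj (χ (b - d))‖ ≤ ‖S3‖ := by
    rw [norm_mul, RCLike.norm_conj]; exact mul_le_of_le_one_right (norm_nonneg _) hC
  have b4 : ‖χ (b - d) * conj S4‖ ≤ ‖S4‖ := by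
    rw [norm_mul, RCLike.norm_conj]; exact mul_le_of_le_one_left (norm_nonneg _) hC
  have hb : |∑ x, f x * rbErr χ x b d| ≤ 2 * ‖S1‖ + ‖S2‖ + ‖S3‖ + ‖S4‖ := by
    rw [e]
    refine (Complex.abs_re_le_norm _).trans ?_
    refine (norm_sub_le _ _).trans ?_
    refine add_le_add ((norm_sub_le _ _).trans (add_le_add ((norm_sub_le _ _).trans
      (add_le_add ?_ ?_)) b3)) b4
    · rw [norm_mul]
      simpa using b1
    · rw [RCLike.norm_conj]
  have h0 := abs_nonneg (∑ x, f x * rbErr χ x b d)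
  rw [← sq_abs]
  have hsq := pow_le_pow_left₀ h0 hb 2
  refine hsq.trans ?_
  nlinarith [sq_nonneg (‖S1‖ - ‖S2‖), sq_nonneg (‖S1‖ - ‖S3‖), sq_nonneg (‖S1‖ - ‖S4‖),
    sq_nonneg (‖S2‖ - ‖S3‖), sq_nonneg (‖S2‖ - ‖S4‖), sq_nonneg (‖S3‖ - ‖S4‖)]

lemma rbErr_l2 (χ : MulChar F ℂ) (hχ : χ ≠ 1) (f : F → ℝ) (B C : Finset F) (M : ℝ)
    (hB : (#B : ℝ) ≤ M) (hC : (#C : ℝ) ≤ M) :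
    ∑ b ∈ B, ∑ d ∈ C, (∑ x, f x * rbErr χ x b d) ^ 2
      ≤ 25 * Fintype.card F * M * ∑ x, f x ^ 2 := by
  set E : ℝ := Fintype.card F * ∑ x, f x ^ 2 with hE
  have hE0 : 0 ≤ E := by positivity
  have aux : ∀ (S : Finset F) (h : F → ℂ), (∀ x, ‖h x‖ ≤ |f x|) →
      ∑ d ∈ S, ‖∑ x, h x * χ (x - d)‖ ^ 2 ≤ E := by
    intro S h hh
    refine (sum_le_univ_sum_of_nonneg (fun _ => by positivity)).trans ?_
    refine (parseval_le χ hχ h).trans ?_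
    rw [hE]
    refine mul_le_mul_of_nonneg_left (sum_le_sum fun x _ => ?_) (Nat.cast_nonneg _)
    rw [← sq_abs (f x)]
    exact pow_le_pow_left₀ (norm_nonneg _) (hh x) 2
  have c1 : ∑ b ∈ B, ∑ d ∈ C, ‖∑ x, ((f x : ℂ) * χ (x - b)) * χ (x - d)‖ ^ 2 ≤ M * E := by
    refine (sum_le_sum fun b _ => aux C _ ?_).trans ?_
    · intro x
      rw [norm_mul, Complex.norm_real, Real.norm_eq_abs]
      exact mul_le_of_le_one_right (abs_nonneg _) (chi_norm_le χ _)
    · rw [sum_const, nsmul_eq_mul]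
      gcongr
  have c2 : ∑ b ∈ B, ∑ d ∈ C, ‖∑ x, ((f x : ℂ) * conj (χ (x - b))) * χ (x - d)‖ ^ 2
      ≤ M * E := by
    refine (sum_le_sum fun b _ => aux C _ ?_).trans ?_
    · intro x
      rw [norm_mul, Complex.norm_real, Real.norm_eq_abs, RCLike.norm_conj]
      exact mul_le_of_le_one_right (abs_nonneg _) (chi_norm_le χ _)
    · rw [sum_const, nsmul_eq_mul]
      gcongr
  have c3 : ∑ b ∈ B, ∑ d ∈ C, ‖∑ x, (f x : ℂ) * χ (x - d)‖ ^ 2 ≤ M * E := by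
    refine (sum_le_sum fun b _ => aux C (fun x => (f x : ℂ)) ?_).trans ?_
    · intro x
      rw [Complex.norm_real, Real.norm_eq_abs]
    · rw [sum_const, nsmul_eq_mul]
      gcongr
  have c4 : ∑ b ∈ B, ∑ d ∈ C, ‖∑ x, (f x : ℂ) * χ (x - b)‖ ^ 2 ≤ M * E := by
    rw [sum_comm]
    refine (sum_le_sum fun b _ => aux B (fun x => (f x : ℂ)) ?_).trans ?_
    · intro x
      rw [Complex.norm_real, Real.norm_eq_abs]
    · rw [sum_const, nsmul_eq_mul]
      gcongr
  refine (sum_le_sum fun b _ => sum_le_sum fun d _ => rbErr_sum_le χ f b d).trans ?_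
  simp only [← mul_sum, sum_add_distrib]
  have : 25 * (Fintype.card F : ℝ) * M * ∑ x, f x ^ 2 = 25 * (M * E) := by rw [hE]; ring
  rw [this]
  linarith

lemma cube_one_cases (r : ℝ) (hr : r ^ 2 = 3 / 4) (A : ℂ) (hA : A ^ 3 = 1) :
    A = 1 ∨ A = ⟨-1 / 2, r⟩ ∨ A = ⟨-1 / 2, -r⟩ := by
  have hI : (r : ℂ) ^ 2 = 3 / 4 := by
    have := congrArg (fun t : ℝ => (t : ℂ)) hr
    push_cast at this
    exact this
  have e1 : (⟨-1 / 2, r⟩ : ℂ) = -1 / 2 + r * Complex.I := by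
    apply Complex.ext <;> simp
  have e2 : (⟨-1 / 2, -r⟩ : ℂ) = -1 / 2 - r * Complex.I := by
    apply Complex.ext <;> simp
  rw [e1, e2]
  have hp : (A - 1) * ((A - (-1 / 2 + r * Complex.I)) * (A - (-1 / 2 - r * Complex.I))) = 0 := by
    linear_combination hA + (A - 1) * hI - (A - 1) * (r : ℂ) ^ 2 * Complex.I_sq
  rcases mul_eq_zero.mp hp with h | h
  · exact Or.inl (sub_eq_zero.mp h)
  · rcases mul_eq_zero.mp h with h | h
    · exact Or.inr (Or.inl (sub_eq_zero.mp h))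
    · exact Or.inr (Or.inr (sub_eq_zero.mp h))

lemma rainbow_value (A B C : ℂ) (hA : A ^ 3 = 1) (hB : B ^ 3 = 1) (hC : C ^ 3 = 1) :
    (A + B + C = 0 ∧ 1 + (2 * (A * B * C) - A * conj B - B * conj C - C * conj A).re = 9 / 2) ∨
    1 + (2 * (A * B * C) - A * conj B - B * conj C - C * conj A).re = 0 := by
  obtain ⟨r, hr⟩ : ∃ r : ℝ, r ^ 2 = 3 / 4 := ⟨√(3 / 4), Real.sq_sqrt (by norm_num)⟩
  have hr2 : r * r = 3 / 4 := by rw [← sq]; exact hr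
  rcases cube_one_cases r hr A hA with rfl | rfl | rfl <;>
  rcases cube_one_cases r hr B hB with rfl | rfl | rfl <;>
  rcases cube_one_cases r hr C hC with rfl | rfl | rfl <;>
  first
  | (right
     simp
     nlinarith [hr2])
  | (left
     constructor
     · apply Complex.ext <;> simp <;> norm_num
     · simp
       nlinarith [hr2])

/-- `{x, b, d}` is a rainbow triangle. -/
def Rb (χ : MulChar F ℂ) (x b d : F) : Prop :=
  (x ≠ b ∧ x ≠ d ∧ b ≠ d) ∧ χ (x - b) + χ (x - d) + χ (b - d) = 0

lemma rbErr_cases (χ : MulChar F ℂ) (h3 : χ ^ 3 = 1) (hneg : χ (-1) = 1) (x b d : F) :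
    (Rb χ x b d ∧ 1 + rbErr χ x b d = 9 / 2) ∨ (x = b ∧ x = d ∧ 1 + rbErr χ x b d = 1) ∨
      1 + rbErr χ x b d = 0 := by
  have hcube : ∀ u : F, u ≠ 0 → χ u ^ 3 = 1 := by
    intro u hu
    rw [← MulChar.pow_apply' χ (by norm_num), h3, MulChar.one_apply hu.isUnit]
  have hnorm : ∀ u : F, u ≠ 0 → χ u * conj (χ u) = 1 := by
    intro u hu
    have := Complex.norm_eq_one_of_pow_eq_one (hcube u hu) (by norm_num)
    rw [Complex.mul_conj', this]
    norm_num
  have hsymm : ∀ u v : F, χ (u - v) = χ (v - u) := by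
    intro u v
    rw [← neg_sub, ← neg_one_mul, map_mul, hneg, one_mul]
  unfold rbErr
  by_cases hxb : x = b
  · by_cases hxd : x = d
    · right; left
      refine ⟨hxb, hxd, ?_⟩
      subst hxb; subst hxd
      simp [MulChar.map_zero]
    · right; right
      subst hxb
      have := hnorm (x - d) (sub_ne_zero.mpr hxd)
      rw [this]
      simp [MulChar.map_zero]
  · by_cases hxd : x = d
    · right; right
      subst hxd
      rw [hsymm b x]
      have := hnorm (x - b) (sub_ne_zero.mpr hxb)
      rw [this]
      simp [MulChar.map_zero]
    · by_cases hbd : b = d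
      · right; right
        subst hbd
        have := hnorm (x - b) (sub_ne_zero.mpr hxb)
        rw [this]
        simp [MulChar.map_zero]
      · rcases rainbow_value (χ (x - b)) (χ (x - d)) (χ (b - d)) (hcube _ (sub_ne_zero.mpr hxb))
          (hcube _ (sub_ne_zero.mpr hxd)) (hcube _ (sub_ne_zero.mpr hbd)) with h | h
        · exact Or.inl ⟨⟨⟨hxb, hxd, hbd⟩, h.1⟩, h.2⟩
        · exact Or.inr (Or.inr h)

/-- Weighted count of apexes `x` making both `{x, a, c}` and `{x, b, d}` rainbow. -/
noncomputable def apex (χ : MulChar F ℂ) (a c b d : F) : ℝ :=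
  ∑ x, (1 + rbErr χ x a c) * (1 + rbErr χ x b d)

lemma apex_l2 (χ : MulChar F ℂ) (hχ : χ ≠ 1) (h3 : χ ^ 3 = 1) (hneg : χ (-1) = 1) :
    ∑ a, ∑ c, ∑ b, ∑ d, (apex χ a c b d - Fintype.card F) ^ 2
      ≤ (3025 / 4) * (Fintype.card F : ℝ) ^ 5 := by
  set q : ℝ := (Fintype.card F : ℝ) with hq
  have hq0 : 0 ≤ q := Nat.cast_nonneg _
  have hcu : ((#(univ : Finset F) : ℕ) : ℝ) = q := by rw [card_univ]
  have hW : ∀ x a c, (1 + rbErr χ x a c) ^ 2 ≤ 81 / 4 := by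
    intro x a c
    rcases rbErr_cases χ h3 hneg x a c with ⟨-, h⟩ | ⟨-, -, h⟩ | h <;> rw [h] <;> norm_num
  have hu : ∀ a c, ∑ b, ∑ d, (∑ x, (1 + rbErr χ x a c) * rbErr χ x b d) ^ 2
      ≤ 25 * q * q * (q * (81 / 4)) := by
    intro a c
    refine (rbErr_l2 χ hχ (fun x => 1 + rbErr χ x a c) univ univ q hcu.le hcu.le).trans ?_
    have : ∑ x, (1 + rbErr χ x a c) ^ 2 ≤ q * (81 / 4) := by
      refine (sum_le_sum fun x _ => hW x a c).trans ?_
      rw [sum_const, nsmul_eq_mul, hcu]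
    rw [← hq]
    gcongr
  have hv : ∑ a, ∑ c, (∑ x, rbErr χ x a c) ^ 2 ≤ 25 * q * q * q := by
    have := rbErr_l2 χ hχ (fun _ => 1) univ univ q hcu.le hcu.le
    simpa [← hq] using this
  have hpt : ∀ a c b d, (apex χ a c b d - q) ^ 2
      ≤ (11 / 9) * (∑ x, (1 + rbErr χ x a c) * rbErr χ x b d) ^ 2
        + (11 / 2) * (∑ x, rbErr χ x a c) ^ 2 := by
    intro a c b d
    have : apex χ a c b d - q = (∑ x, (1 + rbErr χ x a c) * rbErr χ x b d)
        + ∑ x, rbErr χ x a c := by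
      unfold apex
      rw [← hcu, cast_card, ← sum_sub_distrib, ← sum_add_distrib]
      apply sum_congr rfl
      intro x _
      ring
    rw [this]
    set u := ∑ x, (1 + rbErr χ x a c) * rbErr χ x b d
    set v := ∑ x, rbErr χ x a c
    nlinarith [sq_nonneg (2 * u - 9 * v)]
  calc ∑ a, ∑ c, ∑ b, ∑ d, (apex χ a c b d - q) ^ 2
      ≤ ∑ a : F, ∑ c : F, ∑ b : F, ∑ d : F,
        ((11 / 9) * (∑ x, (1 + rbErr χ x a c) * rbErr χ x b d) ^ 2
        + (11 / 2) * (∑ x, rbErr χ x a c) ^ 2) := by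
        gcongr with a _ c _ b _ d _
        exact hpt a c b d
    _ = (11 / 9) * (∑ a : F, ∑ c : F, ∑ b : F, ∑ d : F,
          (∑ x, (1 + rbErr χ x a c) * rbErr χ x b d) ^ 2)
        + (11 / 2) * (q * q * ∑ a : F, ∑ c : F, (∑ x, rbErr χ x a c) ^ 2) := by
        simp only [sum_add_distrib, ← mul_sum, sum_const, nsmul_eq_mul, hcu]
        ring
    _ ≤ (11 / 9) * (∑ a : F, ∑ c : F, 25 * q * q * (q * (81 / 4)))
        + (11 / 2) * (q * q * (25 * q * q * q)) := by
        gcongr with a _ c _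
        exact hu a c
    _ = (3025 / 4) * q ^ 5 := by
        simp only [sum_const, nsmul_eq_mul, hcu]
        ring

lemma exists_good_quad (χ : MulChar F ℂ) (hχ : χ ≠ 1) (h3 : χ ^ 3 = 1) (hneg : χ (-1) = 1)
    (hq : 25000 ≤ Fintype.card F) :
    ∃ a b c d : F, (a ≠ b ∧ a ≠ c ∧ a ≠ d ∧ b ≠ c ∧ b ≠ d ∧ c ≠ d) ∧
      (apex χ a c b d - Fintype.card F) ^ 2 + (apex χ a d b c - Fintype.card F) ^ 2
        + (apex χ a b c d - Fintype.card F) ^ 2 ≤ 2270 * (Fintype.card F : ℝ) := by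
  have hqr : (25000 : ℝ) ≤ Fintype.card F := by exact_mod_cast hq
  have hcu : ((#(univ : Finset F) : ℕ) : ℝ) = Fintype.card F := by rw [card_univ]
  have hl2 := apex_l2 χ hχ h3 hneg
  set q : ℝ := (Fintype.card F : ℝ)
  by_contra hcon
  push Not at hcon
  have s1 : ∑ a, ∑ b, ∑ c, ∑ d, (apex χ a c b d - q) ^ 2 ≤ (3025 / 4) * q ^ 5 := by
    refine le_of_eq_of_le ?_ hl2
    exact sum_congr rfl fun a _ => sum_comm
  have s2 : ∑ a, ∑ b, ∑ c, ∑ d, (apex χ a d b c - q) ^ 2 ≤ (3025 / 4) * q ^ 5 := by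
    refine le_of_eq_of_le ?_ hl2
    refine sum_congr rfl fun a _ => ?_
    rw [sum_congr rfl fun b _ => sum_comm]
    rw [sum_comm]
  have s3 : ∑ a, ∑ b, ∑ c, ∑ d, (apex χ a b c d - q) ^ 2 ≤ (3025 / 4) * q ^ 5 := hl2
  have hpt : ∀ a b c d : F, 2270 * q * (1 - (if a = b then 1 else 0) - (if a = c then 1 else 0)
      - (if a = d then 1 else 0) - (if b = c then 1 else 0) - (if b = d then 1 else 0)
      - (if c = d then 1 else 0)) ≤ (apex χ a c b d - q) ^ 2 + (apex χ a d b c - q) ^ 2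
        + (apex χ a b c d - q) ^ 2 := by
    intro a b c d
    have hnn : 0 ≤ (apex χ a c b d - q) ^ 2 + (apex χ a d b c - q) ^ 2
        + (apex χ a b c d - q) ^ 2 := by positivity
    by_cases hd : a ≠ b ∧ a ≠ c ∧ a ≠ d ∧ b ≠ c ∧ b ≠ d ∧ c ≠ d
    · have := hcon a b c d hd
      obtain ⟨h1, h2, h3, h4, h5, h6⟩ := hd
      simp only [h1, h2, h3, h4, h5, h6, if_false]
      linarith
    · refine le_trans ?_ hnn
      apply mul_nonpos_of_nonneg_of_nonpos (by linarith)
      by_contra hpos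
      push Not at hpos
      apply hd
      have i0 : ∀ p : Prop, ∀ [Decidable p], (0 : ℝ) ≤ if p then 1 else 0 := by
        intro p _; split_ifs <;> norm_num
      have j1 := i0 (a = b)
      have j2 := i0 (a = c)
      have j3 := i0 (a = d)
      have j4 := i0 (b = c)
      have j5 := i0 (b = d)
      have j6 := i0 (c = d)
      refine ⟨?_, ?_, ?_, ?_, ?_, ?_⟩ <;> intro h <;>
        simp only [if_pos h] at hpos <;> linarith
  have htot : ∑ a : F, ∑ b : F, ∑ c : F, ∑ d : F,
      (2270 * q * (1 - (if a = b then 1 else 0) - (if a = c then 1 else 0)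
      - (if a = d then 1 else 0) - (if b = c then 1 else 0) - (if b = d then 1 else 0)
      - (if c = d then 1 else 0)))
      ≤ ∑ a : F, ∑ b : F, ∑ c : F, ∑ d : F,
        ((apex χ a c b d - q) ^ 2 + (apex χ a d b c - q) ^ 2 + (apex χ a b c d - q) ^ 2) := by
    gcongr with a _ b _ c _ d _
    exact hpt a b c d
  have hlhs : ∑ a : F, ∑ b : F, ∑ c : F, ∑ d : F,
      (2270 * q * (1 - (if a = b then 1 else 0) - (if a = c then 1 else 0)
      - (if a = d then 1 else 0) - (if b = c then 1 else 0) - (if b = d then 1 else 0)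
      - (if c = d then 1 else 0))) = 2270 * q * (q ^ 4 - 6 * q ^ 3) := by
    simp only [← mul_sum, sum_sub_distrib, sum_const, nsmul_eq_mul, hcu, sum_ite_eq, mem_univ,
      if_true]
    ring
  rw [hlhs] at htot
  simp only [sum_add_distrib] at htot
  have hfin : 2270 * q * (q ^ 4 - 6 * q ^ 3) ≤ 3 * (3025 / 4 * q ^ 5) := by linarith
  have hq4 : 0 < q ^ 4 := by positivity
  have : 2270 * (q - 6) ≤ 9075 / 4 * q := by
    have e1 : q ^ 4 * (2270 * (q - 6)) ≤ q ^ 4 * (9075 / 4 * q) := by linarith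
    exact le_of_mul_le_mul_left e1 hq4
  linarith

lemma apex_card (χ : MulChar F ℂ) (h3 : χ ^ 3 = 1) (hneg : χ (-1) = 1) (a c b d : F)
    (hac : a ≠ c) (hbd : b ≠ d) (N : ℕ) (hN : (81 / 4 : ℝ) * N ≤ apex χ a c b d) :
    ∃ A : Finset F, #A = N ∧ ∀ x ∈ A, Rb χ x a c ∧ Rb χ x b d := by
  classical
  let A0 : Finset F := univ.filter fun x => Rb χ x a c ∧ Rb χ x b d
  have h1 : apex χ a c b d ≤ (81 / 4) * #A0 := by
    unfold apex
    rw [← nsmul_eq_mul', ← sum_const, sum_filter]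
    apply sum_le_sum
    intro x _
    split_ifs with h
    · have hb : ∀ u v : F, 0 ≤ 1 + rbErr χ x u v ∧ 1 + rbErr χ x u v ≤ 9 / 2 := by
        intro u v
        rcases rbErr_cases χ h3 hneg x u v with ⟨-, h⟩ | ⟨-, -, h⟩ | h <;> rw [h] <;> norm_num
      have := mul_le_mul (hb a c).2 (hb b d).2 (hb b d).1 (by norm_num)
      linarith
    · rcases rbErr_cases χ h3 hneg x a c with ⟨h4, _⟩ | ⟨h4, h5, _⟩ | h5
      · rcases rbErr_cases χ h3 hneg x b d with ⟨h6, _⟩ | ⟨h6, h7, _⟩ | h7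
        · exact absurd ⟨h4, h6⟩ h
        · exact absurd (h6.symm.trans h7) hbd
        · rw [h7, mul_zero]
      · exact absurd (h4.symm.trans h5) hac
      · rw [h5, zero_mul]
  have h2 : N ≤ #A0 := by
    have : (81 / 4 : ℝ) * N ≤ (81 / 4) * #A0 := hN.trans h1
    have h' : (N : ℝ) ≤ #A0 := le_of_mul_le_mul_left this (by norm_num)
    exact_mod_cast h'
  obtain ⟨A, hA, hc⟩ := exists_subset_card_eq h2
  refine ⟨A, hc, fun x hx => ?_⟩
  have := hA hx
  simpa [A0] using this

lemma exists_rainbow_triple (χ : MulChar F ℂ) (hχ : χ ≠ 1) (h3 : χ ^ 3 = 1) (hneg : χ (-1) = 1)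
    (N : ℕ) (A B C : Finset F) (hA : #A = N) (hB : #B = N) (hC : #C = N)
    (hN : 5 * √(Fintype.card F : ℝ) + 1 ≤ N) :
    ∃ x ∈ A, ∃ y ∈ B, ∃ z ∈ C, Rb χ x y z := by
  classical
  by_contra hcon
  push Not at hcon
  set q : ℝ := (Fintype.card F : ℝ) with hq
  have hq0 : 0 ≤ q := Nat.cast_nonneg _
  set f : F → ℝ := fun x => if x ∈ A then 1 else 0 with hf
  have hAf : ∑ x, f x = N := by simp [hf, hA]
  have hAf2 : ∑ x, f x ^ 2 = N := by simp [hf, hA]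
  have hl2 := rbErr_l2 χ hχ f B C N (by rw [hB]) (by rw [hC])
  rw [hAf2, ← hq] at hl2
  -- upper bound for the total weight
  have hup : ∑ y ∈ B, ∑ z ∈ C, ∑ x, f x * (1 + rbErr χ x y z) ≤ N := by
    have hpt : ∀ y ∈ B, ∀ z ∈ C, ∑ x, f x * (1 + rbErr χ x y z) ≤ if y = z then 1 else 0 := by
      intro y hy z hz
      have hx : ∀ x, f x * (1 + rbErr χ x y z) ≤ if x = y ∧ y = z then 1 else 0 := by
        intro x
        by_cases hxA : x ∈ A
        · simp only [hf, hxA, if_true, one_mul]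
          rcases rbErr_cases χ h3 hneg x y z with ⟨h4, _⟩ | ⟨h4, h5, h6⟩ | h5
          · exact absurd h4 (hcon x hxA y hy z hz)
          · rw [h6, if_pos ⟨h4, h4.symm.trans h5⟩]
          · rw [h5]; split_ifs <;> norm_num
        · simp only [hf, hxA, if_false, zero_mul]
          split_ifs <;> norm_num
      refine (sum_le_sum fun x _ => hx x).trans ?_
      by_cases hyz : y = z
      · simp [hyz]
      · simp [hyz]
    refine (sum_le_sum fun y hy => sum_le_sum fun z hz => hpt y hy z hz).trans ?_
    have : ∀ y ∈ B, ∑ z ∈ C, (if y = z then (1 : ℝ) else 0) ≤ 1 := by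
      intro y _
      rw [sum_ite_eq]
      split_ifs <;> norm_num
    refine (sum_le_sum this).trans ?_
    simp [hB]
  have hsplit : ∑ y ∈ B, ∑ z ∈ C, ∑ x, f x * (1 + rbErr χ x y z)
      = (N : ℝ) ^ 3 + ∑ y ∈ B, ∑ z ∈ C, ∑ x, f x * rbErr χ x y z := by
    simp only [mul_add, mul_one, sum_add_distrib, hAf, sum_const, nsmul_eq_mul, hB, hC]
    ring
  set E := ∑ y ∈ B, ∑ z ∈ C, ∑ x, f x * rbErr χ x y z with hE
  have hcs : E ^ 2 ≤ (N : ℝ) ^ 2 * (25 * q * N * N) := by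
    have e1 : E = ∑ p ∈ B ×ˢ C, ∑ x, f x * rbErr χ x p.1 p.2 := by
      rw [hE, sum_product]
    have e2 : ∑ y ∈ B, ∑ z ∈ C, (∑ x, f x * rbErr χ x y z) ^ 2
        = ∑ p ∈ B ×ˢ C, (∑ x, f x * rbErr χ x p.1 p.2) ^ 2 := by
      rw [sum_product]
    have := sq_sum_le_card_mul_sum_sq (s := B ×ˢ C)
      (f := fun p => ∑ x, f x * rbErr χ x p.1 p.2)
    rw [← e1, ← e2, card_product, hB, hC] at this
    refine this.trans ?_
    push_cast
    rw [← sq]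
    gcongr
  set s := √q with hs
  have hs0 : 0 ≤ s := Real.sqrt_nonneg _
  have hs2 : s ^ 2 = q := Real.sq_sqrt hq0
  have hN1 : (1 : ℝ) ≤ N := by linarith
  have hEb : |E| ≤ 5 * s * (N : ℝ) ^ 2 := by
    apply abs_le_of_sq_le_sq _ (by positivity)
    refine hcs.trans (le_of_eq ?_)
    rw [← hs2]; ring
  have hE2 := (abs_le.mp hEb).1
  have hkey : (N : ℝ) ^ 3 - 5 * s * (N : ℝ) ^ 2 ≤ N := by linarith
  have hN2 : (N : ℝ) ^ 2 * 1 ≤ (N : ℝ) ^ 2 * (N - 5 * s) :=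
    mul_le_mul_of_nonneg_left (by linarith) (by positivity)
  have hN3 : (N : ℝ) ^ 2 ≤ N := by nlinarith
  have hN4 : (N : ℝ) ≤ 1 := by nlinarith
  have hs00 : s = 0 := by linarith
  have hqpos : 0 < q := by
    rw [hq]
    exact_mod_cast Fintype.card_pos
  rw [hs00] at hs2
  norm_num at hs2
  linarith

lemma Rb.swap {χ : MulChar F ℂ} (hneg : χ (-1) = 1) {x b d : F} (h : Rb χ x b d) :
    Rb χ b d x ∧ Rb χ d x b ∧ Rb χ x d b ∧ Rb χ b x d ∧ Rb χ d b x := by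
  have hsymm : ∀ u v : F, χ (u - v) = χ (v - u) := by
    intro u v
    rw [← neg_sub, ← neg_one_mul, map_mul, hneg, one_mul]
  obtain ⟨⟨h1, h2, h3⟩, h4⟩ := h
  refine ⟨⟨⟨h3, h1.symm, h2.symm⟩, ?_⟩, ⟨⟨h2.symm, h3.symm, h1⟩, ?_⟩, ⟨⟨h2, h1, h3.symm⟩, ?_⟩,
    ⟨⟨h1.symm, h3, h2⟩, ?_⟩, ⟨⟨h3.symm, h2.symm, h1.symm⟩, ?_⟩⟩
  · rw [hsymm b x, hsymm d x]; linear_combination h4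
  · rw [hsymm d b, hsymm d x]; linear_combination h4
  · rw [hsymm d b]; linear_combination h4
  · rw [hsymm b x]; linear_combination h4
  · rw [hsymm d b, hsymm b x, hsymm d x]; linear_combination h4

theorem exists_FKDF_of_large (hq : 25000 ≤ Fintype.card F) (h6 : Fintype.card F % 6 = 1) :
    ∃ 𝓕 : Multiset (Fin 7 → F), IsFKDF 𝓕 := by
  obtain ⟨χ, hord⟩ := MulChar.exists_mulChar_orderOf F (n := 3) (R := ℂ) (by omega)
    (Complex.isPrimitiveRoot_exp 3 (by norm_num))
  have h3 : χ ^ 3 = 1 := by rw [← hord]; exact pow_orderOf_eq_one χ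
  have hχ : χ ≠ 1 := by
    rintro rfl
    simp at hord
  have hcube : ∀ u : F, u ≠ 0 → χ u ^ 3 = 1 := by
    intro u hu
    rw [← MulChar.pow_apply' χ (by norm_num), h3, MulChar.one_apply hu.isUnit]
  have hneg : χ (-1) = 1 := by
    have e1 := hcube (-1) (by simp)
    have e2 : χ (-1) ^ 2 = 1 := by rw [← map_pow]; simp
    linear_combination e1 - χ (-1) * e2
  have h2 : (-1 : F) ≠ 1 := by
    apply Ring.neg_one_ne_one_of_char_ne_two
    intro h
    have := FiniteField.even_card_of_char_two h
    omega
  obtain ⟨a, b, c, d, ⟨hab, hac, had, hbc, hbd, hcd⟩, hT⟩ := exists_good_quad χ hχ h3 hneg hq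
  have hqr : (25000 : ℝ) ≤ Fintype.card F := by exact_mod_cast hq
  set q : ℝ := (Fintype.card F : ℝ) with hqdef
  set s := √q with hs
  have hs0 : 0 ≤ s := Real.sqrt_nonneg _
  have hs2 : s ^ 2 = q := Real.sq_sqrt (by linarith)
  have hs158 : 158 ≤ s := by
    apply Real.le_sqrt_of_sq_le
    linarith
  have hlow : ∀ t : ℝ, (t - q) ^ 2 ≤ 2270 * q → (81 / 4 : ℝ) * (5 * s + 2) ≤ t := by
    intro t ht
    have : |t - q| ≤ 48 * s := by
      apply abs_le_of_sq_le_sq _ (by positivity)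
      rw [mul_pow, hs2]
      linarith
    have h' := (abs_le.mp this).1
    rw [← hs2] at h'
    nlinarith
  let N : ℕ := ⌈5 * s⌉₊ + 1
  have hN1 : 5 * s + 1 ≤ N := by
    have := Nat.le_ceil (5 * s)
    simp only [N]
    push_cast
    linarith
  have hN2 : (N : ℝ) ≤ 5 * s + 2 := by
    have := (Nat.ceil_lt_add_one (a := 5 * s) (by positivity)).le
    simp only [N]
    push_cast
    linarith
  have sq1 := sq_nonneg (apex χ a c b d - q)
  have sq2 := sq_nonneg (apex χ a d b c - q)
  have sq3 := sq_nonneg (apex χ a b c d - q)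
  obtain ⟨A, hA, hAr⟩ := apex_card χ h3 hneg a c b d hac hbd N
    (le_trans (by linarith) (hlow _ (by linarith)))
  obtain ⟨B, hB, hBr⟩ := apex_card χ h3 hneg a d b c had hbc N
    (le_trans (by linarith) (hlow _ (by linarith)))
  obtain ⟨C, hC, hCr⟩ := apex_card χ h3 hneg a b c d hab hcd N
    (le_trans (by linarith) (hlow _ (by linarith)))
  obtain ⟨x, hx, y, hy, z, hz, hr⟩ := exists_rainbow_triple χ hχ h3 hneg N A B C hA hB hC hN1
  obtain ⟨rx1, rx2⟩ := hAr x hx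
  obtain ⟨ry1, ry2⟩ := hBr y hy
  obtain ⟨rz1, rz2⟩ := hCr z hz
  -- points: 0 ↦ x, 1 ↦ y, 3 ↦ z, and 2, 4, 5, 6 ↦ a, d, b, c
  refine exists_FKDF_of_rainbow (χ : F →* ℂ) (by norm_num) hcube hneg h2
    ![x, y, a, z, d, b, c] ?_
  have key : ∀ u v w : F, Rb χ u v w → (u ≠ v ∧ u ≠ w ∧ v ≠ w) ∧
      (χ : F →* ℂ) (u - v) + (χ : F →* ℂ) (u - w) + (χ : F →* ℂ) (v - w) = 0 :=
    fun u v w h => h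
  intro j
  fin_cases j
  · exact key x y z hr
  · exact key y a d ry1
  · exact key a z b (rz1.swap hneg).2.2.2.1
  · exact key z d c (rz2.swap hneg).2.2.1
  · exact key d b x (rx2.swap hneg).2.2.2.2
  · exact key b c y (ry2.swap hneg).1
  · exact key c x a (rx1.swap hneg).2.1

end PartD

section PartE

/-- A line check expressed through `k`-th powers. -/
def LineOK {F : Type*} [Field F] (k : ℕ) (x y z : F) : Prop :=
  (x - y) ^ k + (x - z) ^ k + (y - z) ^ k = 0 ∧ (x - y) ^ k * ((x - z) ^ k * (y - z) ^ k) = 1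

theorem exists_FKDF_of_lineOK {F : Type*} [Field F] [Fintype F] [DecidableEq F] (k : ℕ)
    (hk : 3 * k + 1 = Fintype.card F) (h6 : Fintype.card F % 6 = 1)
    (b0 b1 b2 b3 b4 b5 b6 : F) (h0 : LineOK k b0 b1 b3) (h1 : LineOK k b1 b2 b4)
    (h2 : LineOK k b2 b3 b5) (h3 : LineOK k b3 b4 b6) (h4 : LineOK k b4 b5 b0)
    (h5 : LineOK k b5 b6 b1) (h6' : LineOK k b6 b0 b2) :
    ∃ 𝓕 : Multiset (Fin 7 → F), IsFKDF 𝓕 := by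
  have hc1 : 1 < Fintype.card F := Fintype.one_lt_card
  have hk0 : k ≠ 0 := by omega
  have hodd : Fintype.card F % 2 = 1 := by omega
  have key : ∀ u v w : F, LineOK k u v w → (u ≠ v ∧ u ≠ w ∧ v ≠ w) ∧
      (powMonoidHom k : F →* F) (u - v) + (powMonoidHom k : F →* F) (u - w) +
        (powMonoidHom k : F →* F) (v - w) = 0 := by
    intro u v w h
    refine ⟨⟨?_, ?_, ?_⟩, h.1⟩
    · rintro rfl
      have := h.2
      simp [hk0] at this
    · rintro rfl
      have := h.2
      simp [hk0] at this
    · rintro rfl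
      have := h.2
      simp [hk0] at this
  refine exists_FKDF_of_rainbow (powMonoidHom k : F →* F) ?_ ?_ ?_ ?_
    ![b0, b1, b2, b3, b4, b5, b6] ?_
  · intro h
    have h3p : ringChar F ∣ 3 := (ringChar.spec F 3).mp (by exact_mod_cast h)
    have hp : (ringChar F).Prime := CharP.char_is_prime F _
    have : ringChar F = 3 := (Nat.prime_dvd_prime_iff_eq hp Nat.prime_three).mp h3p
    obtain ⟨n, -, hn⟩ := FiniteField.card F (ringChar F)
    rw [this] at hn
    have : 3 ∣ Fintype.card F := by
      rw [hn]
      exact dvd_pow_self 3 n.ne_zero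
    omega
  · intro u hu
    have := FiniteField.pow_card_sub_one_eq_one u hu
    rw [← hk] at this
    simp only [powMonoidHom_apply, ← pow_mul]
    rw [mul_comm k 3]
    simpa using this
  · simp only [powMonoidHom_apply]
    exact Even.neg_one_pow (by rw [Nat.even_iff]; omega)
  · apply Ring.neg_one_ne_one_of_char_ne_two
    intro h
    have := FiniteField.even_card_of_char_two h
    omega
  · intro j
    fin_cases j
    · exact key b0 b1 b3 h0
    · exact key b1 b2 b4 h1
    · exact key b2 b3 b5 h2
    · exact key b3 b4 b6 h3
    · exact key b4 b5 b0 h4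
    · exact key b5 b6 b1 h5
    · exact key b6 b0 b2 h6'

/-- Apply a Boolean line test to all seven lines. -/
def chk7 {M : Type*} (l : M → M → M → Bool) (b0 b1 b2 b3 b4 b5 b6 : M) : Bool :=
  l b0 b1 b3 && (l b1 b2 b4 && (l b2 b3 b5 && (l b3 b4 b6 && (l b4 b5 b0 && (l b5 b6 b1 &&
    l b6 b0 b2)))))

theorem exists_FKDF_of_chk7 {F M : Type*} [Field F] [Fintype F] [DecidableEq F] (k : ℕ)
    (hk : 3 * k + 1 = Fintype.card F) (h6 : Fintype.card F % 6 = 1) (φ : M → F)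
    (l : M → M → M → Bool) (hl : ∀ x y z, l x y z = true → LineOK k (φ x) (φ y) (φ z))
    (b0 b1 b2 b3 b4 b5 b6 : M) (h : chk7 l b0 b1 b2 b3 b4 b5 b6 = true) :
    ∃ 𝓕 : Multiset (Fin 7 → F), IsFKDF 𝓕 := by
  simp only [chk7, Bool.and_eq_true] at h
  obtain ⟨h0, h1, h2, h3, h4, h5, h6'⟩ := h
  exact exists_FKDF_of_lineOK k hk h6 _ _ _ _ _ _ _ (hl _ _ _ h0) (hl _ _ _ h1) (hl _ _ _ h2)
    (hl _ _ _ h3) (hl _ _ _ h4) (hl _ _ _ h5) (hl _ _ _ h6')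

/-! ### Prime fields -/

/-- `|x - y| ^ k mod p`. -/
def pVal (p k x y : ℕ) : ℕ :=
  Nat.mod (Nat.pow (Nat.add (Nat.sub x y) (Nat.sub y x)) k) p

/-- The line test in a prime field. -/
def pLine (p k x y z : ℕ) : Bool :=
  Nat.beq (Nat.mod (Nat.add (Nat.add (pVal p k x y) (pVal p k x z)) (pVal p k y z)) p) 0 &&
  Nat.beq (Nat.mod (Nat.mul (pVal p k x y) (Nat.mul (pVal p k x z) (pVal p k y z))) p) 1

theorem pVal_cast (p : ℕ) [NeZero p] (k : ℕ) (hk : Even k) (x y : ℕ) :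
    ((pVal p k x y : ℕ) : ZMod p) = ((x : ZMod p) - y) ^ k := by
  have e : pVal p k x y = ((x - y) + (y - x)) ^ k % p := rfl
  rw [e, ZMod.natCast_mod]
  rcases le_total x y with h | h
  · rw [Nat.sub_eq_zero_of_le h, zero_add]
    push_cast [h]
    rw [← hk.neg_pow, neg_sub]
  · rw [Nat.sub_eq_zero_of_le h, add_zero]
    push_cast [h]
    rfl

theorem pLine_sound (p : ℕ) [Fact p.Prime] (k : ℕ) (hk : Even k) (x y z : ℕ)
    (h : pLine p k x y z = true) : LineOK k (x : ZMod p) (y : ZMod p) (z : ZMod p) := by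
  simp only [pLine, Bool.and_eq_true] at h
  obtain ⟨h1, h2⟩ := h
  have h1 := Nat.eq_of_beq_eq_true h1
  have h2 := Nat.eq_of_beq_eq_true h2
  constructor
  · rw [← pVal_cast p k hk, ← pVal_cast p k hk, ← pVal_cast p k hk, ← Nat.cast_add,
      ← Nat.cast_add, ZMod.natCast_eq_zero_iff]
    exact Nat.dvd_of_mod_eq_zero h1
  · rw [← pVal_cast p k hk, ← pVal_cast p k hk, ← pVal_cast p k hk, ← Nat.cast_mul,
      ← Nat.cast_mul, ← ZMod.natCast_mod]
    have h2' : (pVal p k x y * (pVal p k x z * pVal p k y z)) % p = 1 := h2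
    rw [h2', Nat.cast_one]

/-- Test of a table entry: a small entry is a proper divisor of `p` (or marks `p = 13`), a
large one encodes the points `b2, …, b6` in base 128. -/
def pEntry (p e : ℕ) : Bool :=
  bif Nat.ble e 157 then
    (Nat.ble 2 e && (Nat.ble (Nat.succ e) p && Nat.beq (Nat.mod p e) 0)) || Nat.beq p 13
  else
    chk7 (pLine p (Nat.div p 3)) 0 1 (Nat.div e 268435456) (Nat.mod (Nat.div e 2097152) 128)
      (Nat.mod (Nat.div e 16384) 128) (Nat.mod (Nat.div e 128) 128) (Nat.mod e 128)

/-- Test of consecutive table entries, starting from `p`. -/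
def pWalk : ℕ → List ℕ → Bool
  | _, [] => true
  | p, e :: l => pEntry p e && pWalk (Nat.add p 6) l

theorem pEntry_sound (p e : ℕ) (hp : p.Prime) (h6 : p % 6 = 1) (h13 : p ≠ 13)
    (h : pEntry p e = true) :
    haveI : Fact p.Prime := ⟨hp⟩
    ∃ 𝓕 : Multiset (Fin 7 → ZMod p), IsFKDF 𝓕 := by
  have : Fact p.Prime := ⟨hp⟩
  rw [pEntry] at h
  cases hb : Nat.ble e 157 with
  | true =>
    rw [hb] at h
    simp only [cond_true, Bool.or_eq_true, Bool.and_eq_true] at h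
    rcases h with ⟨h1, h2, h3⟩ | h
    · exfalso
      have h1 := Nat.le_of_ble_eq_true h1
      have h2 := Nat.le_of_ble_eq_true h2
      have h4 : e ∣ p := Nat.dvd_of_mod_eq_zero (Nat.eq_of_beq_eq_true h3)
      rcases (Nat.dvd_prime hp).mp h4 with h | h <;> omega
    · exact absurd (Nat.eq_of_beq_eq_true h) h13
  | false =>
    rw [hb] at h
    simp only [cond_false] at h
    have hd : Nat.div p 3 = p / 3 := rfl
    rw [hd] at h
    refine exists_FKDF_of_chk7 (p / 3) ?_ ?_ (fun n : ℕ => (n : ZMod p)) (pLine p (p / 3)) ?_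
      _ _ _ _ _ _ _ h
    · rw [ZMod.card]; omega
    · rw [ZMod.card]; exact h6
    · intro x y z hxyz
      exact pLine_sound p _ (by rw [Nat.even_iff]; omega) x y z hxyz

theorem pWalk_sound (l : List ℕ) : ∀ (p₀ : ℕ), pWalk p₀ l = true → ∀ p, p % 6 = 1 → p₀ % 6 = 1 →
    p₀ ≤ p → p < p₀ + 6 * l.length → ∃ e, pEntry p e = true := by
  induction l with
  | nil =>
    intro p₀ _ p _ _ h1 h2
    simp at h2
    omega
  | cons e l ih =>
    intro p₀ h p hp hp0 h1 h2
    simp only [pWalk, Bool.and_eq_true] at h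
    by_cases hpe : p = p₀
    · exact ⟨e, hpe ▸ h.1⟩
    · have h' : pWalk (p₀ + 6) l = true := h.2
      simp only [List.length_cons] at h2
      exact ih (p₀ + 6) h' p hp (by omega) (by omega) (by omega)

/-- Table for `7 ≤ p < 2527`. -/
def pTab0 : List ℕ :=
  [543228550, 1, 545342856, 5, 562251783, 543229830, 1625425550, 7, 5, 547587978, 551749262,
   549570956, 545606792, 5, 7, 549749640, 572834830, 558024854, 5, 11, 1671728662, 7, 841024270,
   5, 1642235283, 564447130, 543229587, 13, 5, 560186115, 11, 820152604, 551684875, 5, 551684875,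
   7, 549801228, 818138261, 5, 1113687180, 13, 11, 7, 5, 572637715, 1099007879, 832669575, 17, 5,
   7, 568689692, 836879763, 11, 5, 1887716873, 576783107, 7, 543230086, 5, 19, 564463768,
   545359628, 1080279818, 5, 17, 828589074, 13, 838928009, 5, 1348699399, 7, 1094846739,
   887654039, 5, 11, 837241873, 1646494989, 7, 5, 13, 834831495, 17, 1656950423, 5, 7, 11,
   820217360, 23, 5, 543228550, 549570444, 7, 13, 5, 543228550, 820217360, 11, 19, 5, 558222502,
   543408775, 570655749, 1088686473, 5, 566527238, 7, 1388614055, 11, 5, 570705547, 23,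
   1887716873, 7, 5, 856049165, 17, 19, 545458190, 5, 7, 1153930137, 612683279, 2453996957, 5,
   543408775, 572835867, 7, 545441032, 5, 11, 547587978, 13, 17, 5, 818103314, 19, 545344147,
   841155716, 5, 29, 7, 1648840203, 572818307, 5, 13, 543228550, 545375496, 7, 5, 17, 572607496,
   11, 560204438, 5, 7, 543228550, 23, 13, 5, 31, 549815825, 7, 11, 5, 547555470, 585505466, 17,
   547556245, 5, 600378543, 13, 543228550, 1116081813, 5, 549570579, 7, 545344136, 551732366, 5,
   23, 570671757, 568673308, 7, 5, 11, 1111934247, 570656403, 545375763, 5, 7, 31, 545359628, 19,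
   5, 543228550, 11, 7, 29, 5, 545637533, 17, 820234636, 23, 5, 587287069, 551684893, 11,
   570655749, 5, 13, 7, 19, 545506824, 5, 543361286, 543441543, 581143322, 7, 5, 830571792,
   558254487, 31, 13, 5, 7, 23, 29, 37, 5, 545375759, 19, 7, 579263655, 5, 17, 13, 833131162,
   579226382, 5, 11, 568624517, 543228550, 1137296915, 5, 1363281683, 7, 830538512, 2424556056,
   5, 19, 11, 17, 7, 5, 572737436, 29, 547605901, 1116327943, 5, 7, 549570826, 11, 818104850, 5,
   37, 598185402, 7, 551749262, 5, 547653770, 1147768083, 23, 11, 5, 13, 583647896, 545375496,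
   839074834, 5, 41, 7, 543228550, 1422102547, 5, 29, 17, 562416280, 7, 5, 543228550, 543426694,
   575194284, 551766414, 5, 7, 818088336, 547669131, 866223368, 5, 549586571, 13, 7, 17, 5,
   1661195037, 11, 19, 43, 5, 585451790, 1386596620, 545817735, 839074834, 5, 31, 7, 11, 23, 5,
   17, 41, 860590615, 7, 5, 570508936, 19, 13, 11, 5, 7, 587645847, 551945493, 577308710, 5,
   843122313, 834831763, 7, 547605901, 5, 13, 23, 545506961, 29, 5, 19, 31, 566478856, 551684366,
   5, 11, 7, 549667980, 13, 5, 549718412, 545441032, 549652107, 7, 5, 1382237455, 11, 41,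
   837158173, 5, 7, 13, 600300731, 47, 5, 560235025, 17, 7, 543425165, 5, 1118012573, 37, 31,
   547587978, 5, 826573831, 893868728, 549570828, 11, 5, 543228550, 7, 23, 17, 5, 560139041,
   562414996, 13, 7, 5, 543228550, 813958413, 600659857, 560235025, 5, 7, 29, 19, 41, 5, 11,
   545343114, 7, 31, 5, 23, 1134642199, 543228550, 37, 5, 47, 11, 1392772626, 13, 5, 551684875]

theorem pTab0_ok : pWalk 7 pTab0 = true := by decide +kernel

/-- Table for `2527 ≤ p < 5047`. -/
def pTab1 : List ℕ :=
  [7, 17, 543228550, 5, 834929928, 549538058, 11, 7, 5, 29, 13, 545343509, 23, 5, 7, 843515802,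
   43, 11, 5, 19, 572736403, 7, 580995211, 5, 600752819, 1371751435, 585191049, 574736011, 5, 37,
   564414341, 547587978, 843154693, 5, 1631864723, 7, 13, 1393083922, 5, 11, 1654803467, 47, 7,
   5, 551864092, 545359503, 610861464, 53, 5, 7, 11, 847466122, 17, 5, 560138902, 543228550, 7,
   19, 5, 43, 545342856, 11, 13, 5, 41, 551684366, 37, 29, 5, 17, 7, 1380254887, 11, 5,
   1384764179, 13, 19, 7, 5, 564448422, 31, 23, 562252696, 5, 7, 1646494989, 17, 549734277, 5,
   568461067, 547555483, 7, 560137878, 5, 11, 19, 29, 570721163, 5, 547456650, 53, 13, 43, 5, 23,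
   7, 558024340, 543228550, 5, 568673308, 818186640, 31, 7, 5, 13, 562317327, 11, 1105560583, 5,
   7, 17, 2697201292, 818104720, 5, 551733774, 29, 7, 11, 5, 545375496, 547456650, 560138632,
   549750661, 5, 551682702, 47, 568673308, 17, 5, 576783107, 7, 1422135435, 31, 5, 549586571, 43,
   41, 7, 5, 11, 23, 543228550, 19, 5, 7, 566839196, 2437206926, 545342986, 5, 59, 11, 7,
   577078183, 5, 543228550, 1084408979, 13, 574720395, 5, 551816999, 543228550, 11, 543228550, 5,
   543228550, 7, 545343624, 37, 5, 13, 568525718, 836832393, 7, 5, 1676346552, 570671757,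
   545458193, 41, 5, 7, 19, 545376648, 13, 5, 551685262, 1134773649, 7, 545441684, 5, 61,
   570738309, 564761497, 572638597, 5, 11, 13, 53, 1107608325, 5, 19, 7, 545343880, 29, 5, 37,
   11, 564760602, 7, 5, 23, 1109689357, 1923335837, 17, 5, 7, 543393427, 11, 560204438, 5, 47,
   560139677, 7, 1111656198, 5, 1101169555, 31, 598002439, 11, 5, 17, 560235025, 29, 23, 5, 13,
   7, 543228550, 19, 5, 1080328973, 549766681, 37, 7, 5, 589482132, 1373996044, 17, 13, 5, 7, 61,
   549587473, 1109689357, 5, 543228550, 23, 7, 558024340, 5, 41, 11, 558155924, 1619150352, 5,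
   43, 1365446806, 47, 59, 5, 560186115, 7, 11, 570721155, 5, 545621256, 19, 545393556, 7, 5,
   838927881, 17, 1109625241, 11, 5, 7, 543459725, 13, 31, 5, 29, 545819399, 7, 566479516, 5, 19,
   1080328973, 543228550, 17, 5, 13, 41, 23, 53, 5, 11, 7, 832669575, 43, 5, 543228550,
   1619134615, 61, 7, 5, 17, 11, 549734423, 67, 5, 7, 1080328973, 1162124707, 1088554771, 5, 23,
   13, 7, 1101447954, 5, 570705299, 820086418, 17, 19, 5, 545621256, 1642235283, 543228550, 11,
   5, 545375496, 7, 41, 814089110, 5, 562169231, 2454277006, 1088785551, 7, 5, 31, 43, 13, 37, 5,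
   7, 53, 545344267, 2202555827, 5, 11, 47, 7, 589482900, 5, 13, 17, 3781430685, 545344136, 5,
   1113753478, 11, 813958413, 61, 5, 1080232198, 7, 29, 13, 5, 543229715, 31, 11, 7, 5, 67, 59,
   543590406, 851840269, 5, 7, 13, 560139670, 11, 5, 547457162, 549750661, 7, 549570188, 5, 17,
   543228550, 818186640, 543359623, 5, 818087184, 29, 1348715783, 47, 5, 71]

theorem pTab1_ok : pWalk 2527 pTab1 = true := by decide +kernel

/-- Table for `5047 ≤ p < 7567`. -/
def pTab2 : List ℕ :=
  [7, 31, 563010200, 5, 11, 560138902, 13, 7, 5, 3048083740, 543228550, 877382586, 543230086, 5,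
   7, 11, 37, 19, 5, 13, 558024340, 7, 1101187218, 5, 29, 654805925, 11, 845366418, 5, 23,
   866358160, 617270799, 13, 5, 59, 7, 19, 11, 5, 1619414664, 17, 67, 7, 5, 47, 13, 1153831187,
   73, 5, 7, 560285846, 53, 23, 5, 41, 19, 7, 17, 5, 11, 813958413, 589482132, 558024596, 5,
   543228550, 549586571, 585188381, 549652107, 5, 43, 7, 13, 543359623, 5, 17, 23, 549570579, 7,
   5, 1109689357, 560139670, 11, 29, 5, 7, 813958413, 543228550, 579165608, 5, 832668944, 37, 7,
   11, 5, 31, 41, 1105495051, 13, 5, 572870151, 1115767833, 1101285142, 860013455, 5, 53, 7,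
   570491651, 543408775, 5, 558252573, 13, 29, 7, 5, 11, 1128744463, 543361286, 543228550, 5, 7,
   73, 23, 545442451, 5, 570655749, 11, 7, 37, 5, 1363708297, 566297363, 19, 547589147, 5,
   839074834, 1348649998, 11, 839189387, 5, 543228550, 7, 71, 17, 5, 23, 61, 543228550, 7, 5, 13,
   19, 1105545479, 59, 5, 7, 43, 31, 53, 5, 17, 558254475, 7, 13, 5, 37, 818103314, 547653770,
   23, 5, 11, 578948615, 576783107, 583392428, 5, 1120175527, 7, 17, 41, 5, 545458190, 11,
   576832780, 7, 5, 566609820, 47, 843301387, 31, 5, 7, 23, 11, 545655699, 5, 578948615,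
   549570579, 7, 813958413, 5, 79, 820217360, 13, 11, 5, 678174158, 545342856, 61, 19, 5,
   583255452, 7, 59, 71, 5, 13, 545621256, 1080232326, 7, 5, 1663207703, 545342986, 591479689,
   1617200653, 5, 7, 560218895, 19, 13, 5, 843301387, 568461454, 7, 47, 5, 562251674, 11, 23,
   543228550, 5, 549768844, 13, 43, 67, 5, 17, 7, 11, 1134758801, 5, 31, 813958413, 551749262, 7,
   5, 543359623, 564398214, 29, 11, 5, 7, 2424539275, 17, 1633798536, 5, 19, 585338011, 7, 61, 5,
   558156303, 59, 549586571, 577098533, 5, 545375759, 37, 547457162, 547490714, 5, 11, 7,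
   560218895, 23, 5, 43, 29, 572608008, 7, 5, 543228550, 11, 545621256, 13, 5, 7, 17, 566527238,
   549749640, 5, 545359503, 41, 7, 19, 5, 558023694, 13, 1122602003, 83, 5, 67, 543229830, 31,
   11, 5, 29, 7, 53, 543228550, 5, 558222490, 560188060, 19, 7, 5, 547573271, 579257611, 47, 43,
   5, 7, 818088336, 13, 551685259, 5, 11, 826476309, 7, 576851609, 5, 73, 19, 41, 31, 5, 13, 11,
   17, 1080232198, 5, 37, 7, 23, 543228550, 5, 71, 562250909, 11, 7, 5, 19, 551684875,
   1103400867, 560137878, 5, 7, 1382237455, 843121925, 11, 5, 53, 13, 7, 29, 5, 23, 545506961,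
   67, 545443223, 5, 551682702, 17, 564464934, 41, 5, 551914125, 7, 37, 1103447453, 5, 11, 83,
   1084492169, 7, 5, 545458197, 1115767833, 13, 17, 5, 7, 11, 29, 545506824, 5, 31, 551635612, 7,
   545376648, 5, 13, 578948615, 11, 73, 5, 17, 1113720711, 19, 583092363, 5, 547457162]

theorem pTab2_ok : pWalk 5047 pTab2 = true := by decide +kernel

/-- Table for `7567 ≤ p < 10087`. -/
def pTab3 : List ℕ :=
  [7, 838959762, 11, 5, 547736969, 71, 579160977, 7, 5, 572869383, 29, 17, 1103400867, 5, 7, 13,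
   79, 570721163, 5, 576914319, 1642235283, 7, 549833996, 5, 11, 835144208, 851855758, 59, 5,
   843301387, 61, 1086473614, 832635658, 5, 19, 7, 43, 1080413702, 5, 29, 37, 13, 7, 5, 41, 17,
   11, 47, 5, 7, 558024852, 1086638090, 564429571, 5, 13, 53, 7, 11, 5, 89, 843156104, 545886356,
   17, 5, 832996761, 73, 1145390106, 13, 5, 23, 7, 1080328973, 19, 5, 657282067, 543228550, 71,
   7, 5, 11, 13, 547457162, 1094846735, 5, 7, 41, 59, 572836876, 5, 612796579, 11, 7, 23, 5, 47,
   79, 17, 29, 5, 562399129, 876942245, 11, 558023700, 5, 879068957, 7, 13, 545458190, 5,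
   549800467, 19, 572737436, 7, 5, 37, 23, 547636872, 832635658, 5, 7, 551733774, 545344147, 43,
   5, 838977931, 616874519, 7, 543228550, 5, 19, 17, 1625425550, 13, 5, 11, 560188060, 83,
   1900351123, 5, 31, 7, 47, 568461454, 5, 543228550, 11, 1631964821, 7, 5, 836862620, 543228550,
   37, 61, 5, 7, 29, 11, 67, 5, 545506961, 1086638090, 7, 572607112, 5, 17, 43, 558367764, 11, 5,
   585385740, 31, 13, 841109004, 5, 79, 7, 545359503, 845419175, 5, 570671757, 549538058, 17, 7,
   5, 13, 1107396490, 19, 814042508, 5, 7, 560139041, 589480340, 558221971, 5, 545621256,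
   574931340, 7, 13, 5, 549586571, 11, 31, 617732308, 5, 59, 19, 576832017, 23, 5, 543443334, 7,
   11, 549570826, 5, 53, 17, 558073756, 7, 5, 83, 843153930, 568691335, 11, 5, 7, 37, 545344392,
   568673308, 5, 562251674, 23, 7, 17, 5, 545441032, 47, 13, 89, 5, 564528924, 568640653,
   818104720, 29, 5, 11, 7, 589432583, 545524884, 5, 13, 564366615, 43, 7, 5, 1122059293, 11,
   560235025, 849612055, 5, 7, 1348682512, 843301387, 13, 5, 572818307, 1388793351, 7, 53, 5,
   551764622, 558024854, 29, 568624517, 5, 61, 13, 23, 11, 5, 543228550, 7, 19, 47, 5, 73,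
   1135199130, 830538512, 7, 5, 71, 41, 67, 543228550, 5, 7, 813958413, 1103349267, 1619150353,
   5, 11, 17, 7, 83, 5, 545441032, 576783107, 562251674, 97, 5, 612813983, 11, 1080232198,
   877382673, 5, 13, 7, 2210711078, 17, 5, 19, 53, 11, 7, 5, 574932133, 31, 89, 13, 5, 7,
   572818307, 41, 11, 5, 17, 61, 7, 43, 5, 560186115, 13, 570738316, 1086638090, 5, 2168867223,
   23, 545342856, 832735368, 5, 545375759, 7, 17, 564398214, 5, 11, 545344136, 31, 7, 5,
   558073747, 71, 543228550, 1631815571, 5, 7, 11, 13, 836912657, 5, 558156692, 558024596, 7, 41,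
   5, 820086034, 848205591, 11, 545441032, 5, 13, 43, 59, 549570444, 5, 543359623, 7, 545342986,
   11, 5, 572638597, 545457939, 23, 7, 5, 1384366998, 19, 61, 597985435, 5, 7, 566478856,
   3001749817, 17, 5, 97, 13, 7, 828801809, 5, 11, 37, 79, 589482515, 5, 19, 89, 29, 543359623,
   5, 17]

theorem pTab3_ok : pWalk 7567 pTab3 = true := by decide +kernel

/-- Table for `10087 ≤ p < 12607`. -/
def pTab4 : List ℕ :=
  [7, 572818959, 583091081, 5, 543228550, 67, 53, 7, 5, 566478856, 73, 11, 2454309774, 5, 7,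
   1101187218, 17, 23, 5, 101, 59, 7, 11, 5, 13, 29, 835148714, 37, 5, 31, 1088686473,
   1386595596, 19, 5, 41, 7, 855805587, 13, 5, 820217360, 23, 558024340, 7, 5, 11, 547555477, 43,
   543228550, 5, 7, 13, 19, 549799055, 5, 29, 11, 7, 828640541, 5, 53, 31, 543228550, 1109689357,
   5, 37, 551846419, 11, 17, 5, 1348682512, 7, 543459725, 67, 5, 560154520, 41, 13, 7, 5, 59,
   562416920, 97, 71, 5, 7, 834931997, 23, 103, 5, 13, 545360268, 7, 560137878, 5, 3532247827,
   1101187218, 551682702, 47, 5, 11, 1084408979, 17, 13, 5, 1080413702, 7, 545342856, 845367557,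
   5, 23, 11, 1088719503, 7, 5, 820282645, 13, 41, 545359503, 5, 7, 101, 11, 31, 5, 1388793351,
   834831495, 7, 19, 5, 2424784266, 549783055, 83, 11, 5, 836864924, 17, 551682702, 545343624, 5,
   67, 7, 13, 560138390, 5, 47, 611674703, 19, 7, 5, 79, 597788315, 543359623, 17, 5, 7, 23, 73,
   41, 5, 61, 560186115, 7, 869195031, 5, 813845516, 11, 549571852, 13, 5, 17, 29, 585849900,
   543228550, 5, 543442950, 7, 11, 1153831827, 5, 2735310753, 13, 1961069856, 7, 5, 19,
   547800600, 17, 11, 5, 7, 103, 47, 836862474, 5, 543228550, 581143322, 7, 59, 5, 29, 826573831,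
   23, 843154693, 5, 1377961748, 543377158, 13, 562251672, 5, 11, 7, 560005905, 37, 5, 83, 31,
   816220175, 7, 5, 13, 11, 101, 19, 5, 7, 543228550, 830538512, 107, 5, 73, 547458442, 7, 13, 5,
   820234013, 543359623, 587285401, 17, 5, 41, 2428749461, 19, 11, 5, 583736483, 7, 31, 23, 5,
   37, 1382237455, 543228550, 7, 5, 17, 560137878, 59, 29, 5, 7, 19, 43, 89, 5, 11, 547457162, 7,
   572607752, 5, 2424784266, 23, 13, 591840799, 5, 1382189321, 11, 545344520, 31, 5, 19, 7, 61,
   543408775, 5, 13, 47, 11, 7, 5, 564761498, 1933821331, 574720395, 549538058, 5, 7, 71,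
   1394869146, 11, 5, 109, 1094929942, 7, 73, 5, 43, 17, 1407782162, 79, 5, 545441032, 13,
   834831763, 574736011, 5, 1422135435, 7, 23, 19, 5, 11, 619633165, 41, 7, 5, 53, 543228550,
   1625573003, 543228550, 5, 7, 11, 1097253654, 47, 5, 107, 1369869461, 7, 568461067, 5, 17, 67,
   11, 61, 5, 29, 543408775, 828641446, 43, 5, 13, 7, 89, 11, 5, 1080232198, 19, 17, 7, 5,
   562251783, 37, 545375496, 13, 5, 7, 566478856, 71, 547589147, 5, 545441032, 31, 7, 97, 5, 11,
   13, 2982794549, 53, 5, 47, 83, 543441543, 838927881, 5, 619628456, 7, 79, 838927881, 5,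
   1365674008, 17, 813958413, 7, 5, 828621586, 558023700, 11, 37, 5, 7, 572589317, 13, 29, 5,
   813958413, 618988710, 7, 11, 5, 830538512, 545344267, 543228550, 19, 5, 13, 3781430685,
   1170561467, 543228550, 5, 543359623]

theorem pTab4_ok : pWalk 10087 pTab4 = true := by decide +kernel

/-- Table for `12607 ≤ p < 15127`. -/
def pTab5 : List ℕ :=
  [7, 549538058, 572638597, 5, 17, 558023700, 47, 7, 5, 11, 53, 19, 31, 5, 7, 543441543,
   2508954275, 71, 5, 572736403, 11, 7, 834929416, 5, 41, 1086571669, 543229702, 113, 5,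
   543228550, 19, 11, 1415879199, 5, 23, 7, 545342986, 543408775, 5, 1086638090, 29, 583255452,
   7, 5, 61, 79, 13, 543228550, 5, 7, 543228550, 37, 572834830, 5, 67, 17, 7, 23, 5, 13,
   1080328973, 583718455, 547587219, 5, 11, 41, 1097108373, 1105545479, 5, 29, 7, 1115767833, 13,
   5, 31, 11, 635638189, 7, 5, 103, 23, 855935623, 545621256, 5, 7, 13, 11, 19, 5, 17, 545672072,
   7, 1101251468, 5, 818186640, 558155790, 841024270, 11, 5, 43, 47, 73, 574952635, 5, 101, 7,
   17, 545342986, 5, 89, 612683279, 13, 7, 5, 562253464, 1134857379, 53, 1088768269, 5, 7,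
   3252946578, 67, 543359623, 5, 13, 19, 7, 29, 5, 572818959, 11, 59, 1088652810, 5, 545343880,
   830538512, 31, 13, 5, 545375496, 7, 11, 43, 5, 19, 583405063, 97, 7, 5, 23, 13, 572638597, 11,
   5, 7, 838927881, 29, 17, 5, 71, 562349958, 7, 37, 5, 1631815571, 1113687310, 61, 31, 5, 53,
   545539598, 818087184, 23, 5, 11, 7, 13, 551749262, 5, 1114214929, 1350845461, 1648577049, 7,
   5, 1386595596, 11, 545375496, 585322121, 5, 7, 59, 17, 1097155218, 5, 47, 23, 7, 566479516, 5,
   37, 1403161612, 19, 13, 5, 839158684, 101, 109, 11, 5, 83, 7, 543228550, 1101187218, 5, 29,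
   13, 543228550, 7, 5, 545344147, 19, 545506824, 53, 5, 7, 17, 543228550, 61, 5, 11, 71, 7,
   1111656326, 5, 564365850, 107, 37, 845366418, 5, 19, 11, 13, 17, 5, 549570826, 7, 558158225,
   73, 5, 59, 549717900, 11, 7, 5, 13, 67, 560186115, 1088719503, 5, 7, 31, 560138902, 11, 5, 23,
   1147443733, 7, 13, 5, 562250909, 41, 43, 29, 5, 543228550, 53, 17, 19, 5, 1088719503, 7,
   883265428, 79, 5, 11, 103, 547490714, 7, 5, 560139670, 549667980, 31, 83, 5, 7, 11, 19,
   1619150361, 5, 551879837, 619947945, 7, 543230086, 5, 543442950, 832669575, 11, 568412814, 5,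
   543377158, 17, 41, 818088336, 5, 43, 7, 1095142035, 11, 5, 13, 73, 564334231, 7, 5,
   1348699399, 549587343, 854166803, 17, 5, 7, 29, 826625683, 13, 5, 19, 47, 7, 576914319, 5, 11,
   97, 838927881, 107, 5, 17, 13, 887459467, 37, 5, 61, 7, 545375759, 41, 5, 619633960,
   545393428, 23, 7, 5, 29, 549570579, 11, 589483284, 5, 7, 547653258, 113, 59, 5, 549570444,
   549684755, 7, 11, 5, 583091081, 83, 89, 1101169548, 5, 23, 545359628, 53, 47, 5, 13, 7,
   545375496, 560138902, 5, 67, 545524884, 19, 7, 5, 11, 17, 1134775443, 13, 5, 7, 43, 545441032,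
   23, 5, 543228550, 11, 7, 101, 5, 813958413, 13, 855886478, 17, 5, 1367655697, 31, 11, 29, 5,
   566478856]

theorem pTab5_ok : pWalk 12607 pTab5 = true := by decide +kernel

/-- Table for `15127 ≤ p < 17647`. -/
def pTab6 : List ℕ :=
  [7, 37, 558452999, 5, 109, 23, 59, 7, 5, 17, 547573271, 549571724, 1086638090, 5, 7, 832635658,
   13, 97, 5, 543230086, 79, 7, 545375759, 5, 591845965, 1357089161, 17, 551962396, 5, 11,
   551684366, 1635895306, 545458190, 5, 591481365, 7, 67, 545344520, 5, 1107429143, 11,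
   1619150353, 7, 5, 562350094, 89, 73, 19, 5, 7, 560137878, 11, 832702225, 5, 1138938649, 13, 7,
   31, 5, 113, 17, 558024340, 11, 5, 543228550, 59, 19, 53, 5, 838961042, 7, 103, 1088785551, 5,
   23, 37, 543228550, 7, 5, 1414323247, 549570826, 13, 866421902, 5, 7, 19, 560204438, 560137878,
   5, 836832393, 545639179, 7, 3599211927, 5, 13, 11, 41, 23, 5, 79, 830571147, 566609820,
   562252184, 5, 19, 7, 11, 13, 5, 43, 543359623, 17, 7, 5, 97, 551846419, 1094929942, 11, 5, 7,
   13, 83, 547605901, 5, 59, 1086638090, 7, 1354990993, 5, 549850005, 612729869, 566907571,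
   826607901, 5, 89, 566609820, 107, 41, 5, 11, 7, 1699817427, 19, 5, 576783107, 17, 13, 7, 5,
   37, 11, 545342986, 43, 5, 7, 568461454, 838961042, 545343509, 5, 13, 570705547, 7, 17, 5,
   1371837343, 71, 23, 127, 5, 545342986, 67, 29, 11, 5, 103, 7, 558023694, 543228550, 5, 17, 19,
   31, 7, 5, 547489425, 13, 37, 1348715783, 5, 7, 818021778, 2707622550, 73, 5, 11, 43, 7, 47, 5,
   19, 29, 545342856, 543228550, 5, 83, 11, 564413701, 1086638090, 5, 543459725, 7, 13, 23, 5,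
   558025247, 545343624, 11, 7, 5, 41, 545342856, 1348682512, 109, 5, 7, 566544282, 53, 11, 5,
   29, 17, 7, 587287069, 5, 61, 23, 71, 13, 5, 551682702, 543228550, 1914832781, 59, 5, 47, 7,
   558023694, 17, 5, 11, 13, 830538512, 7, 5, 545524884, 585356188, 19, 79, 5, 7, 11, 549734277,
   1384285331, 5, 17, 73, 7, 1124716325, 5, 818104720, 591840790, 11, 543229702, 5, 31, 19, 13,
   103, 5, 53, 7, 17, 11, 5, 1109689357, 113, 543408775, 7, 5, 13, 101, 47, 2477099277, 5, 7, 61,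
   545343624, 37, 5, 585302934, 843301387, 7, 13, 5, 11, 31, 585189149, 71, 5, 545343624,
   576848524, 545344270, 89, 5, 558187016, 7, 29, 633920017, 5, 568461067, 1101169548, 549684755,
   7, 5, 43, 1111656198, 11, 23, 5, 7, 1384285331, 109, 17, 5, 37, 543408775, 7, 11, 5, 131,
   543359623, 13, 41, 5, 1625425550, 29, 830538512, 564332951, 5, 17, 7, 19, 547457162, 5, 13,
   547571864, 61, 7, 5, 11, 59, 1145490066, 543231366, 5, 7, 549717900, 17, 13, 5, 566544284, 11,
   7, 568461454, 5, 29, 545393428, 608766389, 543230086, 5, 834931997, 13, 11, 558024596, 5,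
   543228550, 7, 543361158, 545375496, 5, 19, 543228550, 101, 7, 5, 587614607, 574720395, 23,
   1619150352, 5, 7, 17, 89, 543408775, 5, 820234013, 97, 7, 549701649, 5, 564413701, 43, 73,
   549799055, 5, 11, 79, 545343624, 17, 5, 13]

theorem pTab6_ok : pWalk 15127 pTab6 = true := by decide +kernel

/-- Table for `17647 ≤ p < 20167`. -/
def pTab7 : List ℕ :=
  [7, 127, 856001805, 5, 41, 11, 591976205, 7, 5, 31, 832668944, 830720406, 13, 5, 7, 545458197,
   11, 2456012302, 5, 1405421991, 109, 7, 23, 5, 558107272, 13, 19, 11, 5, 71, 543228550, 17,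
   816039437, 5, 543228550, 7, 1099304205, 107, 5, 543228550, 31, 29, 7, 5, 572902151, 19,
   572819876, 543228550, 5, 7, 131, 13, 2699233422, 5, 545441032, 818087184, 7, 543377158, 5, 47,
   11, 543393427, 37, 5, 13, 17, 545344270, 1116181395, 5, 1122273673, 7, 11, 101, 5, 79,
   1134773529, 43, 7, 5, 1101285142, 857901341, 4337308071, 11, 5, 7, 67, 41, 545441032, 5,
   543491869, 13, 7, 568691335, 5, 562169231, 545524884, 906304933, 547573271, 5, 17, 71,
   826573831, 19, 5, 11, 7, 47, 575129500, 5, 549784601, 617662425, 579160078, 7, 5, 23, 11, 13,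
   59, 5, 7, 813958413, 19, 1631815571, 5, 53, 1363462409, 7, 41, 5, 13, 818186640, 568592781,
   545359503, 5, 543408775, 1084408979, 37, 11, 5, 547587978, 7, 860013455, 13, 5, 107,
   577046694, 818023058, 7, 5, 1631913628, 17, 543230086, 67, 5, 7, 13, 820086034, 29, 5, 11, 23,
   7, 43, 5, 31, 1914832781, 103, 17, 5, 560338701, 11, 71, 549570444, 5, 543228550, 7, 59, 53,
   5, 97, 61, 11, 7, 5, 17, 1384582806, 29, 137, 5, 7, 814154653, 1357154697, 11, 5, 13, 31, 7,
   19, 5, 83, 47, 17, 545375496, 5, 113, 43, 23, 13, 5, 41, 7, 1348715783, 543228550, 5, 11, 29,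
   19, 7, 5, 67, 13, 543228550, 832996761, 5, 7, 11, 31, 583451402, 5, 23, 53, 7, 79, 5,
   566478108, 17, 11, 1080312589, 5, 2187959333, 1925665298, 61, 71, 5, 29, 7, 13, 11, 5,
   545457939, 41, 107, 7, 5, 19, 127, 1451462823, 31, 5, 7, 543228550, 589563028, 820381844, 5,
   545458190, 813843356, 7, 1371751435, 5, 11, 545441032, 568689692, 13, 5, 101, 23, 97,
   1625425550, 5, 139, 7, 543228550, 83, 5, 37, 13, 17, 7, 5, 543229830, 572819340, 11, 19, 5, 7,
   1101432585, 1101251468, 549586571, 5, 830571792, 818021773, 7, 11, 5, 545442451, 577046694,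
   543359623, 576948101, 5, 545375759, 836912657, 13, 131, 5, 1451890586, 7, 543228550, 113, 5,
   31, 17, 23, 7, 5, 11, 545360268, 566315281, 1117915930, 5, 7, 19, 29, 41, 5, 43, 11, 7, 13, 5,
   2168736922, 1384366998, 47, 835259671, 5, 23, 564200595, 11, 109, 5, 19, 7, 818021773,
   549667980, 5, 17, 583946775, 73, 7, 5, 1621264526, 29, 1923335837, 549833996, 5, 7, 83,
   3270218146, 23, 5, 562252440, 845219593, 7, 103, 5, 1109610128, 101, 13, 43, 5, 11, 843532819,
   31, 127, 5, 71, 7, 1113867405, 19, 5, 13, 11, 545768741, 7, 5, 876873383, 37, 572818307,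
   551684494, 5, 7, 570721155, 11, 13, 5, 543408775, 17, 7, 543228550, 5, 826410771, 818087184,
   545441032, 11, 5, 41, 13, 847809553, 1651067174, 5, 572934551]

theorem pTab7_ok : pWalk 17647 pTab7 = true := by decide +kernel

/-- Table for `20167 ≤ p < 22687`. -/
def pTab8 : List ℕ :=
  [7, 2695038738, 17, 5, 61, 19, 89, 7, 5, 73, 113, 820152604, 37, 5, 7, 47, 23, 549750661, 5,
   17, 549570444, 7, 53, 5, 19, 11, 830538512, 29, 5, 545375496, 1101432601, 1111656198,
   847628066, 5, 13, 7, 11, 1917175325, 5, 23, 2177290517, 137, 7, 5, 570738309, 107, 543459719,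
   11, 5, 7, 97, 59, 545621256, 5, 31, 103, 7, 564414342, 5, 830538512, 13, 573080344, 19, 5,
   545819399, 61, 562252952, 67, 5, 11, 7, 1128744463, 543228550, 5, 545360268, 53, 41, 7, 5,
   562251667, 11, 19, 73, 5, 7, 23, 13, 17, 5, 127, 560204438, 7, 551683859, 5, 1351091224, 89,
   600180387, 830571792, 5, 13, 19, 1367655697, 11, 5, 17, 7, 71, 870482837, 5, 47, 59, 83, 7, 5,
   29, 551684875, 31, 41, 5, 7, 543377158, 17, 545375496, 5, 11, 13, 7, 843122313, 5, 43,
   826410771, 23, 598187351, 5, 67, 11, 558025620, 139, 5, 562349199, 7, 543228550, 1094929942,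
   5, 543228550, 109, 11, 7, 5, 818021773, 818088336, 13, 107, 5, 7, 17, 47, 11, 5, 566297363,
   37, 7, 549783061, 5, 13, 2460403469, 545344392, 857967901, 5, 59, 1390609680, 602115341, 17,
   5, 545375496, 7, 19, 13, 5, 11, 543228550, 53, 7, 5, 89, 634061989, 585833877, 61, 5, 7, 11,
   1350845469, 543228550, 5, 83, 19, 7, 37, 5, 41, 23, 11, 560186115, 5, 583091081, 572638597,
   17, 79, 5, 31, 7, 551764622, 11, 5, 19, 43, 13, 7, 5, 579476903, 576832780, 583419142,
   568461067, 5, 7, 866421902, 830571792, 818104720, 5, 13, 29, 7, 1925614223, 5, 11, 610966196,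
   113, 832866183, 5, 551635731, 17, 830538512, 13, 5, 97, 7, 23, 545507464, 5, 1625523848, 47,
   545539598, 7, 5, 109, 13, 11, 17, 5, 7, 560169481, 103, 830538512, 5, 545655699, 545375496, 7,
   11, 5, 23, 1525585354, 19, 566479516, 5, 17, 551749262, 139, 83, 5, 545621256, 7, 13,
   562251672, 5, 549799055, 131, 79, 7, 5, 11, 19, 17, 23, 5, 7, 551685656, 570721163, 47, 5,
   549684755, 11, 7, 31, 5, 585500433, 835148330, 547457162, 13, 5, 19, 589793289, 11, 549734415,
   5, 543228550, 7, 816039437, 29, 5, 71, 13, 2211041943, 7, 5, 564429725, 17, 543377158,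
   2437205646, 5, 7, 1117964558, 543228550, 549734277, 5, 1644480014, 67, 7, 543228550, 5, 149,
   53, 97, 17, 5, 11, 37, 13, 19, 5, 113, 7, 1084408979, 545343627, 5, 818103314, 11, 551685656,
   7, 5, 13, 83, 23, 89, 5, 7, 79, 11, 543228550, 5, 543228550, 61, 7, 13, 5, 73, 29, 17, 11, 5,
   849612055, 543408775, 2437188003, 37, 5, 23, 7, 2428749461, 43, 5, 578896777, 71, 47, 7, 5,
   549570188, 31, 583091081, 543442950, 5, 7, 866272524, 545604877, 67, 5, 19, 59, 7, 23, 5,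
   545343112, 11, 13, 558025620, 5, 575348132, 139, 131, 583451402, 5, 37]

theorem pTab8_ok : pWalk 20167 pTab8 = true := by decide +kernel

/-- Table for `22687 ≤ p < 25003`. -/
def pTab9 : List ℕ :=
  [7, 11, 2160347027, 5, 13, 547573271, 31, 7, 5, 1099007879, 23, 61, 11, 5, 7, 1422593977,
   545375496, 13, 5, 151, 1113720711, 7, 19, 5, 17, 41, 53, 73, 5, 564429326, 13, 89, 137, 5, 11,
   7, 37, 31, 5, 562349958, 101, 17, 7, 5, 59, 11, 845366536, 103, 5, 7, 127, 543228550, 109, 5,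
   816039437, 818103314, 7, 545342856, 5, 828507923, 19, 830571792, 1094846735, 5, 566527238, 47,
   41, 11, 5, 13, 7, 29, 61, 5, 549652107, 17, 4377233946, 7, 5, 19, 843122313, 1676254648, 13,
   5, 7, 549570188, 549652107, 1373998732, 5, 11, 2995046429, 7, 17, 5, 545458190, 13, 43,
   1382189321, 5, 31, 11, 866223368, 23, 5, 1902265875, 7, 83, 41, 5, 17, 37, 11, 7, 5,
   562382862, 97, 67, 19, 5, 7, 89, 13, 11, 5, 1086638090, 23, 7, 131, 5, 29, 31, 583209111, 53,
   5, 13, 543228550, 19, 545375496, 5, 43, 7, 101, 543228550, 5, 11, 543228550, 881213989, 7, 5,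
   558155924, 103, 549570826, 1099255059, 5, 7, 11, 838961042, 1382237455, 5, 47, 13, 7, 59, 5,
   551732366, 1931904016, 11, 1887717257, 5, 137, 151, 23, 1642235283, 5, 19, 7, 558156692, 11,
   5, 543228550, 543228550, 849774606, 7, 5, 37, 53, 13, 29, 5, 7, 579160078, 602745662, 31, 5,
   17, 549570188, 7, 820381844, 5, 11, 574932493, 543228550, 543228550, 5, 551832581, 545343880,
   47, 830720263, 5, 89, 7, 17, 13, 5, 564708895, 589482132, 29, 7, 5, 549572643, 949070749, 11,
   568624517, 5, 7, 13, 545442451, 543228550, 5, 818104720, 41, 7, 11, 5, 566479516, 543408775,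
   549735309, 570737669, 5, 549718940, 23, 820184851, 101, 5, 1631815571, 7, 73, 562253976, 5,
   1631915667, 19, 13, 7, 5, 11, 61, 543228550, 549538058, 5, 7, 545621256, 79, 17, 5, 13, 11, 7,
   107, 5, 19, 109, 41, 83, 5, 29, 1642204820, 11, 13, 5, 17, 7, 1925665298, 1134775443, 5,
   883164820, 31, 23, 7, 5, 1372393401, 13, 53, 547605901, 5, 7, 37, 17, 1422466195, 5,
   547457162, 47, 7, 543228550, 5, 127, 558024852, 137, 19, 5, 11, 547800600, 43, 41, 5,
   835328682, 7, 13, 67, 5, 73, 11, 151, 7, 5, 826576153, 71, 19, 157, 5, 7, 17, 11, 23, 5,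
   543228550, 547457162, 7, 545637661, 5, 59, 79, 579359384, 11, 5, 53, 19, 1094929942, 17, 5,
   834831495, 7, 597969929, 562399129, 5, 43, 13, 103, 7, 5, 1094929942, 543228550, 29,
   549538058, 5, 7, 566479516, 149, 558024596, 5, 37, 1109724423, 7, 543228550, 5, 107, 11,
   818087184, 61, 5, 109, 545604877, 13, 545506961, 5, 67, 7]

theorem pTab9_ok : pWalk 22687 pTab9 = true := by decide +kernel

theorem exists_FKDF_zmod_small (p : ℕ) (hp : p.Prime) (h6 : p % 6 = 1) (h13 : p ≠ 13)
    (hlt : p < 25000) :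
    haveI : Fact p.Prime := ⟨hp⟩
    ∃ 𝓕 : Multiset (Fin 7 → ZMod p), IsFKDF 𝓕 := by
  have hp2 := hp.two_le
  have key : ∃ e, pEntry p e = true := by
    rcases lt_or_ge p 2527 with h | h
    · exact pWalk_sound pTab0 7 pTab0_ok p h6 (by norm_num) (by omega)
        (lt_of_lt_of_le h (by decide +kernel))
    rcases lt_or_ge p 5047 with h | h
    · exact pWalk_sound pTab1 2527 pTab1_ok p h6 (by norm_num) (by omega)
        (lt_of_lt_of_le h (by decide +kernel))
    rcases lt_or_ge p 7567 with h | h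
    · exact pWalk_sound pTab2 5047 pTab2_ok p h6 (by norm_num) (by omega)
        (lt_of_lt_of_le h (by decide +kernel))
    rcases lt_or_ge p 10087 with h | h
    · exact pWalk_sound pTab3 7567 pTab3_ok p h6 (by norm_num) (by omega)
        (lt_of_lt_of_le h (by decide +kernel))
    rcases lt_or_ge p 12607 with h | h
    · exact pWalk_sound pTab4 10087 pTab4_ok p h6 (by norm_num) (by omega)
        (lt_of_lt_of_le h (by decide +kernel))
    rcases lt_or_ge p 15127 with h | h
    · exact pWalk_sound pTab5 12607 pTab5_ok p h6 (by norm_num) (by omega)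
        (lt_of_lt_of_le h (by decide +kernel))
    rcases lt_or_ge p 17647 with h | h
    · exact pWalk_sound pTab6 15127 pTab6_ok p h6 (by norm_num) (by omega)
        (lt_of_lt_of_le h (by decide +kernel))
    rcases lt_or_ge p 20167 with h | h
    · exact pWalk_sound pTab7 17647 pTab7_ok p h6 (by norm_num) (by omega)
        (lt_of_lt_of_le h (by decide +kernel))
    rcases lt_or_ge p 22687 with h | h
    · exact pWalk_sound pTab8 20167 pTab8_ok p h6 (by norm_num) (by omega)
        (lt_of_lt_of_le h (by decide +kernel))
    exact pWalk_sound pTab9 22687 pTab9_ok p h6 (by norm_num) (by omega)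
      (lt_of_lt_of_le hlt (by decide +kernel))
  obtain ⟨e, he⟩ := key
  exact pEntry_sound p e hp h6 h13 he

/-! ### Small extension fields -/

/-- The element `a + b θ + c θ ^ 2` described by a triple of natural numbers. -/
def xEval {F : Type*} [Field F] (θ : F) (x : ℕ × ℕ × ℕ) : F :=
  (x.1 : F) + (x.2.1 : F) * θ + (x.2.2 : F) * θ ^ 2

/-- Multiplication when `θ ^ 2 = r` in characteristic `p`. -/
def xMul2 (p r : ℕ) (x y : ℕ × ℕ × ℕ) : ℕ × ℕ × ℕ :=
  (((x.1 + r * x.2.2) * (y.1 + r * y.2.2) + r * (x.2.1 * y.2.1)) % p,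
    ((x.1 + r * x.2.2) * y.2.1 + x.2.1 * (y.1 + r * y.2.2)) % p, 0)

/-- Multiplication when `θ ^ 3 = r` in characteristic `p`. -/
def xMul3 (p r : ℕ) (x y : ℕ × ℕ × ℕ) : ℕ × ℕ × ℕ :=
  ((x.1 * y.1 + r * (x.2.1 * y.2.2 + x.2.2 * y.2.1)) % p,
    (x.1 * y.2.1 + x.2.1 * y.1 + r * (x.2.2 * y.2.2)) % p,
    (x.1 * y.2.2 + x.2.1 * y.2.1 + x.2.2 * y.1) % p)

/-- Fast exponentiation. -/
def xPow (mul : ℕ × ℕ × ℕ → ℕ × ℕ × ℕ → ℕ × ℕ × ℕ) : ℕ → ℕ × ℕ × ℕ → ℕ → ℕ × ℕ × ℕ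
  | 0, _, _ => (1, 0, 0)
  | f + 1, x, k =>
    bif Nat.beq (k % 2) 1 then mul x (xPow mul f (mul x x) (k / 2))
    else xPow mul f (mul x x) (k / 2)

/-- Difference of two triples. -/
def xSub (p : ℕ) (x y : ℕ × ℕ × ℕ) : ℕ × ℕ × ℕ :=
  (x.1 + (p - y.1), x.2.1 + (p - y.2.1), x.2.2 + (p - y.2.2))

/-- Do all coordinates lie within the range `0, …, p`? -/
def xRange (p : ℕ) (x : ℕ × ℕ × ℕ) : Bool :=
  Nat.ble x.1 p && (Nat.ble x.2.1 p && Nat.ble x.2.2 p)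

/-- Zero test for sums of three triples. -/
def xSumZero (p : ℕ) (x y z : ℕ × ℕ × ℕ) : Bool :=
  Nat.beq ((x.1 + y.1 + z.1) % p) 0 && (Nat.beq ((x.2.1 + y.2.1 + z.2.1) % p) 0 &&
    Nat.beq ((x.2.2 + y.2.2 + z.2.2) % p) 0)

/-- Test whether a triple is the unit element. -/
def xIsOne (x : ℕ × ℕ × ℕ) : Bool :=
  Nat.beq x.1 1 && (Nat.beq x.2.1 0 && Nat.beq x.2.2 0)

/-- The line test, on the values of the cubic character. -/
def xTest (mul : ℕ × ℕ × ℕ → ℕ × ℕ × ℕ → ℕ × ℕ × ℕ) (p : ℕ) (u v w : ℕ × ℕ × ℕ) : Bool :=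
  xSumZero p u v w && xIsOne (mul u (mul v w))

/-- The line test. -/
def xLine (mul : ℕ × ℕ × ℕ → ℕ × ℕ × ℕ → ℕ × ℕ × ℕ) (p k : ℕ) (x y z : ℕ × ℕ × ℕ) : Bool :=
  (xRange p y && xRange p z) &&
  xTest mul p (xPow mul 14 (xSub p x y) k) (xPow mul 14 (xSub p x z) k)
    (xPow mul 14 (xSub p y z) k)

section Model

variable {F : Type*} [Field F] (p : ℕ) [CharP F p] (θ : F)

theorem natCast_mod_char (n : ℕ) : ((n % p : ℕ) : F) = n := by
  conv_rhs => rw [← Nat.mod_add_div n p]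
  push_cast
  rw [CharP.cast_eq_zero F p]
  ring

theorem xMul2_sound (r : ℕ) (hθ : θ ^ 2 = r) (x y : ℕ × ℕ × ℕ) :
    xEval θ (xMul2 p r x y) = xEval θ x * xEval θ y := by
  simp only [xEval, xMul2, natCast_mod_char]
  push_cast
  rw [hθ]
  linear_combination (-(x.2.1 : F) * y.2.1) * hθ

theorem xMul3_sound (r : ℕ) (hθ : θ ^ 3 = r) (x y : ℕ × ℕ × ℕ) :
    xEval θ (xMul3 p r x y) = xEval θ x * xEval θ y := by
  simp only [xEval, xMul3, natCast_mod_char]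
  push_cast
  linear_combination (-(x.2.1 : F) * y.2.2 - x.2.2 * y.2.1 - x.2.2 * y.2.2 * θ) * hθ

theorem xPow_sound (mul : ℕ × ℕ × ℕ → ℕ × ℕ × ℕ → ℕ × ℕ × ℕ)
    (hmul : ∀ x y, xEval θ (mul x y) = xEval θ x * xEval θ y)
    (f : ℕ) : ∀ (x : ℕ × ℕ × ℕ) (k : ℕ), k < 2 ^ f →
    xEval θ (xPow mul f x k) = xEval θ x ^ k := by
  induction f with
  | zero =>
    intro x k hk
    obtain rfl : k = 0 := by simpa using hk
    simp [xPow, xEval]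
  | succ f ih =>
    intro x k hk
    have hk' : k / 2 < 2 ^ f := by rw [pow_succ] at hk; omega
    rw [xPow]
    cases hb : Nat.beq (k % 2) 1 with
    | true =>
      have hb := Nat.eq_of_beq_eq_true hb
      have e : xEval θ x ^ k = xEval θ x ^ (2 * (k / 2) + 1) := by congr 1; omega
      rw [cond_true, hmul, ih _ _ hk', hmul, e, pow_succ, pow_mul]
      ring
    | false =>
      have hb := Nat.ne_of_beq_eq_false hb
      have e : xEval θ x ^ k = xEval θ x ^ (2 * (k / 2)) := by congr 1; omega
      rw [cond_false, ih _ _ hk', hmul, e, pow_mul]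
      ring

theorem xLine_sound (mul : ℕ × ℕ × ℕ → ℕ × ℕ × ℕ → ℕ × ℕ × ℕ)
    (hmul : ∀ x y, xEval θ (mul x y) = xEval θ x * xEval θ y)
    (k : ℕ) (hk : k < 2 ^ 14) (x y z : ℕ × ℕ × ℕ)
    (h : xLine mul p k x y z = true) : LineOK k (xEval θ x) (xEval θ y) (xEval θ z) := by
  have hsub : ∀ x y : ℕ × ℕ × ℕ, xRange p y = true →
      xEval θ (xSub p x y) = xEval θ x - xEval θ y := by
    intro x y hy
    simp only [xRange, Bool.and_eq_true] at hy
    obtain ⟨h1, h2, h3⟩ := hy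
    have h1 := Nat.le_of_ble_eq_true h1
    have h2 := Nat.le_of_ble_eq_true h2
    have h3 := Nat.le_of_ble_eq_true h3
    simp only [xEval, xSub]
    push_cast [h1, h2, h3]
    rw [CharP.cast_eq_zero F p]
    ring
  have hone : ∀ x, xIsOne x = true → xEval θ x = 1 := by
    intro x hx
    simp only [xIsOne, Bool.and_eq_true] at hx
    obtain ⟨h1, h2, h3⟩ := hx
    rw [xEval, Nat.eq_of_beq_eq_true h1, Nat.eq_of_beq_eq_true h2, Nat.eq_of_beq_eq_true h3]
    simp
  have hzero : ∀ x y z, xSumZero p x y z = true → xEval θ x + xEval θ y + xEval θ z = 0 := by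
    intro x y z hx
    simp only [xSumZero, Bool.and_eq_true] at hx
    obtain ⟨h1, h2, h3⟩ := hx
    have g : ∀ a b c : ℕ, Nat.beq ((a + b + c) % p) 0 = true → (a : F) + b + c = 0 := by
      intro a b c h
      have := natCast_mod_char (F := F) p (a + b + c)
      rw [Nat.eq_of_beq_eq_true h] at this
      push_cast at this
      exact this.symm
    simp only [xEval]
    linear_combination g _ _ _ h1 + θ * g _ _ _ h2 + θ ^ 2 * g _ _ _ h3
  simp only [xLine, xTest, Bool.and_eq_true] at h
  obtain ⟨⟨hy, hz⟩, h1, h2⟩ := h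
  have e1 := hzero _ _ _ h1
  have e2 := hone _ h2
  simp only [hmul] at e2
  rw [xPow_sound θ mul hmul 14 _ k hk, xPow_sound θ mul hmul 14 _ k hk,
    xPow_sound θ mul hmul 14 _ k hk, hsub _ _ hy, hsub _ _ hz, hsub _ _ hz] at e1 e2
  exact ⟨e1, e2⟩

end Model

theorem exists_FKDF_of_quadratic {F : Type*} [Field F] [Fintype F] [DecidableEq F] (p : ℕ)
    [CharP F p] (hcard : Fintype.card F = p ^ 2) (h6 : Fintype.card F % 6 = 1)
    (r : ℕ) (hr : r % p ≠ 0 ∧ Nat.mod (Nat.pow r (p ^ 2 / 2)) p = 1) (hp158 : p < 158)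
    (b0 b1 b2 b3 b4 b5 b6 : ℕ × ℕ × ℕ)
    (h : chk7 (xLine (xMul2 p r) p (p ^ 2 / 3)) b0 b1 b2 b3 b4 b5 b6 = true) :
    ∃ 𝓕 : Multiset (Fin 7 → F), IsFKDF 𝓕 := by
  have hchar : ringChar F ≠ 2 := by
    intro h
    have := FiniteField.even_card_of_char_two h
    omega
  have hr0 : (r : F) ≠ 0 := by
    rw [Ne, CharP.cast_eq_zero_iff F p]
    exact fun h => hr.1 (Nat.mod_eq_zero_of_dvd h)
  have hr1 : (r : F) ^ (Fintype.card F / 2) = 1 := by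
    have e := natCast_mod_char (F := F) p (r ^ (p ^ 2 / 2))
    have e' : r ^ (p ^ 2 / 2) % p = 1 := hr.2
    rw [e'] at e
    push_cast at e
    rw [hcard]
    exact e.symm
  obtain ⟨θ, hθ⟩ := (FiniteField.isSquare_iff hchar hr0).mpr hr1
  have hθ2 : θ ^ 2 = r := by rw [hθ]; ring
  have hb : p ^ 2 ≤ 157 ^ 2 := Nat.pow_le_pow_left (by omega) 2
  refine exists_FKDF_of_chk7 (p ^ 2 / 3) (by omega) h6 (xEval θ) _ ?_ _ _ _ _ _ _ _ h
  exact fun x y z => xLine_sound p θ _ (xMul2_sound p θ r hθ2) _ (by omega) x y z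

theorem exists_FKDF_of_cubic {F : Type*} [Field F] [Fintype F] [DecidableEq F]
    [CharP F 13] (hcard : Fintype.card F = 13 ^ 3) :
    ∃ 𝓕 : Multiset (Fin 7 → F), IsFKDF 𝓕 := by
  have hchar : (2 : F) ≠ 0 := by
    have := (CharP.cast_eq_zero_iff F 13 2).not.mpr (by norm_num)
    exact_mod_cast this
  have hr1 : (2 : F) ^ 732 = 1 := by
    have e := natCast_mod_char (F := F) 13 (2 ^ 732)
    have e' : 2 ^ 732 % 13 = 1 := by decide +kernel
    rw [e'] at e
    rw [Nat.cast_pow, Nat.cast_one] at e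
    exact e.symm
  obtain ⟨g, hg⟩ := IsCyclic.exists_generator (α := Fˣ)
  obtain ⟨m, hm⟩ := Subgroup.mem_zpowers_iff.mp (hg (Units.mk0 2 hchar))
  have hord : orderOf g = 2196 := by
    rw [orderOf_eq_card_of_forall_mem_zpowers hg, Nat.card_eq_fintype_card, Fintype.card_units,
      hcard]
    norm_num
  have hdiv : (2196 : ℤ) ∣ m * 732 := by
    have h1 : g ^ (m * 732) = 1 := by
      rw [zpow_mul, hm]
      apply Units.ext
      exact hr1
    have := orderOf_dvd_iff_zpow_eq_one.mpr h1
    rw [hord] at this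
    exact_mod_cast this
  obtain ⟨t, ht⟩ : (3 : ℤ) ∣ m := by omega
  have hθ : ((g ^ t : Fˣ) : F) ^ 3 = (2 : ℕ) := by
    have h1 : (g ^ t) ^ 3 = Units.mk0 2 hchar := by
      rw [← hm, ht, mul_comm, zpow_mul]
      rfl
    have := congrArg (fun u : Fˣ => (u : F)) h1
    simpa using this
  refine exists_FKDF_of_chk7 732 (by omega) (by omega) (xEval ((g ^ t : Fˣ) : F))
    (xLine (xMul3 13 2) 13 732) ?_ (0, 0, 0) (1, 0, 0) (2, 0, 0) (7, 1, 0) (8, 1, 0) (12, 0, 0)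
    (8, 3, 0) (by decide +kernel)
  exact fun x y z => xLine_sound 13 _ _ (xMul3_sound 13 _ 2 hθ) _ (by norm_num) x y z

theorem exists_FKDF_169 {F : Type*} [Field F] [Fintype F] [DecidableEq F]
    [CharP F 13] (hcard : Fintype.card F = 13 ^ 2) :
    ∃ 𝓕 : Multiset (Fin 7 → F), IsFKDF 𝓕 :=
  exists_FKDF_of_quadratic 13 hcard (by omega) 2 (by decide +kernel) (by norm_num)
    (0, 0, 0) (1, 0, 0) (2, 0, 0) (3, 1, 0) (5, 3, 0) (3, 2, 0) (3, 4, 0) (by decide +kernel)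

theorem exists_FKDF_sq_small {F : Type*} [Field F] [Fintype F] [DecidableEq F] (p : ℕ)
    [CharP F p] (hp : p.Prime) (h5 : p % 6 = 5) (hlt : p < 158)
    (hcard : Fintype.card F = p ^ 2) :
    ∃ 𝓕 : Multiset (Fin 7 → F), IsFKDF 𝓕 := by
  have h6 : Fintype.card F % 6 = 1 := by rw [hcard, Nat.pow_mod, h5]
  have main : ∀ r b2 b3 b4 b5 b6, (r % p ≠ 0 ∧ Nat.mod (Nat.pow r (p ^ 2 / 2)) p = 1) ∧
      chk7 (xLine (xMul2 p r) p (p ^ 2 / 3)) (0, 0, 0) (1, 0, 0) b2 b3 b4 b5 b6 = true →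
      ∃ 𝓕 : Multiset (Fin 7 → F), IsFKDF 𝓕 := fun r b2 b3 b4 b5 b6 h =>
    exists_FKDF_of_quadratic p hcard h6 r h.1 hlt _ _ b2 b3 b4 b5 b6 h.2
  clear hcard h6
  obtain ⟨n, rfl⟩ : ∃ n, p = 6 * n + 5 := ⟨p / 6, by omega⟩
  have hn : n < 26 := by omega
  interval_cases n
  · exact main 2 (2, 0, 0) (3, 1, 0) (0, 3, 0) (3, 2, 0) (1, 3, 0) (by decide +kernel)
  · exact main 2 (2, 0, 0) (5, 1, 0) (4, 2, 0) (0, 4, 0) (5, 3, 0) (by decide +kernel)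
  · exact main 3 (2, 0, 0) (3, 1, 0) (0, 1, 0) (2, 2, 0) (1, 3, 0) (by decide +kernel)
  · exact main 5 (2, 0, 0) (4, 1, 0) (4, 3, 0) (3, 2, 0) (1, 4, 0) (by decide +kernel)
  · exact main 2 (2, 0, 0) (4, 1, 0) (3, 4, 0) (1, 2, 0) (5, 1, 0) (by decide +kernel)
  · exact absurd hp (by norm_num)
  · exact main 3 (1, 1, 0) (5, 1, 0) (2, 3, 0) (3, 4, 0) (3, 5, 0) (by decide +kernel)
  · exact main 5 (5, 1, 0) (2, 3, 0) (1, 2, 0) (4, 3, 0) (3, 5, 0) (by decide +kernel)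
  · exact main 2 (3, 0, 0) (3, 3, 0) (2, 1, 0) (0, 2, 0) (1, 1, 0) (by decide +kernel)
  · exact main 2 (1, 1, 0) (4, 1, 0) (2, 5, 0) (2, 4, 0) (3, 4, 0) (by decide +kernel)
  · exact absurd hp (by norm_num)
  · exact main 7 (2, 0, 0) (3, 1, 0) (0, 2, 0) (1, 1, 0) (3, 3, 0) (by decide +kernel)
  · exact absurd hp (by norm_num)
  · exact main 2 (2, 0, 0) (3, 2, 0) (5, 2, 0) (5, 1, 0) (4, 5, 0) (by decide +kernel)
  · exact main 3 (2, 1, 0) (3, 2, 0) (0, 3, 0) (1, 2, 0) (3, 1, 0) (by decide +kernel)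
  · exact absurd hp (by norm_num)
  · exact main 2 (2, 0, 0) (4, 2, 0) (5, 2, 0) (2, 3, 0) (1, 4, 0) (by decide +kernel)
  · exact main 2 (3, 0, 0) (3, 3, 0) (2, 1, 0) (0, 2, 0) (1, 1, 0) (by decide +kernel)
  · exact main 3 (2, 0, 0) (2, 1, 0) (0, 1, 0) (3, 3, 0) (1, 2, 0) (by decide +kernel)
  · exact absurd hp (by norm_num)
  · exact absurd hp (by norm_num)
  · exact main 2 (2, 0, 0) (5, 1, 0) (5, 2, 0) (4, 2, 0) (1, 4, 0) (by decide +kernel)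
  · exact main 3 (2, 0, 0) (2, 1, 0) (0, 1, 0) (3, 3, 0) (1, 2, 0) (by decide +kernel)
  · exact absurd hp (by norm_num)
  · exact main 2 (3, 0, 0) (3, 2, 0) (2, 1, 0) (0, 4, 0) (2, 3, 0) (by decide +kernel)
  · exact absurd hp (by norm_num)

end PartE

/-! ### Assembly -/

theorem exists_FKDF_of_card {F : Type} [Field F] [Fintype F] [DecidableEq F]
    (h6 : Fintype.card F % 6 = 1) (h13 : Fintype.card F ≠ 13) :
    ∃ 𝓕 : Multiset (Fin 7 → F), IsFKDF 𝓕 := by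
  by_cases hbig : 25000 ≤ Fintype.card F
  · exact exists_FKDF_of_large hbig h6
  obtain ⟨p, hchar⟩ := CharP.exists F
  obtain ⟨⟨n, hn0⟩, hp, hn⟩ := FiniteField.card F p
  simp only [PNat.mk_coe] at hn
  have : Fact p.Prime := ⟨hp⟩
  let : Algebra (ZMod p) F := ZMod.algebra F p
  have hple : p ≤ Fintype.card F := by
    rw [hn]
    exact Nat.le_self_pow hn0.ne' p
  have hmod : ∀ a : ℕ, a ∣ p → a ∣ Fintype.card F := by
    intro a ha
    rw [hn]
    exact ha.trans (dvd_pow_self p hn0.ne')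
  have hp6 : p % 6 = 1 ∨ p % 6 = 5 := by
    have h2 : ¬ 2 ∣ p := fun h => by have := hmod 2 h; omega
    have h3 : ¬ 3 ∣ p := fun h => by have := hmod 3 h; omega
    omega
  rcases hp6 with hp6 | hp6
  · by_cases hp13 : p = 13
    · subst hp13
      have hn4 : n < 4 := by
        by_contra hcon
        have : 13 ^ 4 ≤ 13 ^ n := Nat.pow_le_pow_right (by norm_num) (by omega)
        omega
      interval_cases n
      · exact absurd hn (by simpa using h13)
      · exact exists_FKDF_169 hn
      · exact exists_FKDF_of_cubic hn
    · exact exists_FKDF_lift (algebraMap (ZMod p) F)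
        (exists_FKDF_zmod_small p hp hp6 hp13 (by omega))
  · have heven : 2 ∣ n := by
      by_contra hcon
      obtain ⟨m, rfl⟩ : ∃ m, n = 2 * m + 1 := ⟨n / 2, by omega⟩
      have : p ^ (2 * m + 1) % 6 = 5 := by
        rw [Nat.pow_mod, hp6, pow_succ, pow_mul, Nat.mul_mod, Nat.pow_mod]
        norm_num
      omega
    have hp158 : p < 158 := by
      by_contra hcon
      have h1 : 161 ^ 2 ≤ p ^ 2 := Nat.pow_le_pow_left (by omega) 2
      have h2 : p ^ 2 ≤ p ^ n := Nat.pow_le_pow_right hp.pos (Nat.le_of_dvd hn0 heven)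
      omega
    have hfr : Module.finrank (ZMod p) F = n := by
      have h1 := Module.card_eq_pow_finrank (K := ZMod p) (V := F)
      rw [hn, ZMod.card] at h1
      exact (Nat.pow_right_injective hp.two_le h1).symm
    classical
    let : Fintype (GaloisField p 2) := Fintype.ofFinite _
    have hgc : Fintype.card (GaloisField p 2) = p ^ 2 := by
      rw [← Nat.card_eq_fintype_card, GaloisField.card p 2 (by norm_num)]
    obtain ⟨ι⟩ := FiniteField.nonempty_algHom_of_finrank_dvd (F := ZMod p)
      (K := GaloisField p 2) (L := F) (by
        rw [GaloisField.finrank p (by norm_num), hfr]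
        exact heven)
    exact exists_FKDF_lift ι.toRingHom (exists_FKDF_sq_small p hp hp6 hp158 hgc)

/-- For every prime power `q ≡ 1 (mod 6)`, `q ≠ 13`, there is a Fano
Kaleidoscopic difference family in the additive group of `F_q`, and consequently an
`(F_q,+)`-regular Fano Kaleidoscope `FK(q)`. -/
theorem exists_FKDF_and_regular_FK_of_prime_power
    (q : ℕ) (hq : IsPrimePow q) (h1 : q % 6 = 1) (h13 : q ≠ 13)
    (F : Type) [Field F] [Fintype F] [DecidableEq F] (hcard : Fintype.card F = q) :
    (∃ 𝓕 : Multiset (Fin 7 → F), IsFKDF 𝓕) ∧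
      (∃ K : Multiset (Fin 7 → Finset F), IsRegularFK F K) := by
  subst hcard
  obtain ⟨𝓕, h𝓕⟩ := exists_FKDF_of_card (F := F) h1 h13
  exact ⟨⟨𝓕, h𝓕⟩, exists_regularFK_of_FKDF 𝓕 h𝓕⟩
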